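/- Let A be the Artin group of type D_4, let (x_0,…,x_5) be a type I 6-cycle, and let x_5' be a left coset of A_ĉ with x_5' ∩ x_0 ≠ ∅ and x_5' ∩ x_4 ≠ ∅ and with x_1, x_3, x_5' pairwise distinct (so that replacing x_5 by x_5' yields an embedded type I 6-cycle). If there exists a left coset z of A_â or of A_b̂ with z ∩ x_1 ≠ ∅, z ∩ x_3 ≠ ∅ and z ∩ x_5' ≠ ∅, then there exists a left coset z' of A_â or of A_b̂ with z' ∩ x_1 ≠ ∅, z' ∩ x_3 ≠ ∅ and z' ∩ x_5 ≠ ∅. -/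

import Mathlib

/-!
The Artin group of type `D₄`, with generators `a, b, c, d`, where `d` is the central node of
the Dynkin diagram: relations `ada = dad`, `bdb = dbd`, `cdc = dcd`, `ab = ba`, `ac = ca`,
`bc = cb`.
-/

open Pointwise

namespace D4Artin

/-- The generators of the `D₄` Artin group. -/
inductive Gen : Type
  | a | b | c | d
deriving DecidableEq

open Gen

/-- The defining relators of the `D₄` Artin group: a braid relation `sts = tst` whenever one of
`s, t` is the central node `d`, and commutation `st = ts` otherwise. -/
def Rels : Set (FreeGroup Gen) :=
  { r | ∃ s t : Gen, s ≠ t ∧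
      (((s = d ∨ t = d) ∧
          r = FreeGroup.of s * FreeGroup.of t * FreeGroup.of s *
              (FreeGroup.of t * FreeGroup.of s * FreeGroup.of t)⁻¹) ∨
        ((s ≠ d ∧ t ≠ d) ∧
          r = FreeGroup.of s * FreeGroup.of t * (FreeGroup.of s)⁻¹ * (FreeGroup.of t)⁻¹)) }

/-- The Artin group of type `D₄`. -/
abbrev Artin : Type := PresentedGroup Rels

/-- The generators, as elements of the Artin group. -/
def gen (s : Gen) : Artin := PresentedGroup.of s

/-- The standard parabolic subgroup `A_ŝ` generated by the three generators other than `s`. -/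
def Ahat (s : Gen) : Subgroup Artin :=
  Subgroup.closure { x | ∃ t : Gen, t ≠ s ∧ x = gen t }

/-- `X` is a left coset of the subgroup `H`. -/
def IsCosetOf (X : Set Artin) (H : Subgroup Artin) : Prop :=
  ∃ g : Artin, X = g • (H : Set Artin)

/-- A type I 6-cycle: `x 0, x 2, x 4` are pairwise distinct left cosets of `A_â`,
`x 1, x 3, x 5` are pairwise distinct left cosets of `A_ĉ`, and consecutive cosets
(indices mod 6) have nonempty intersection. -/
def TypeI (x : Fin 6 → Set Artin) : Prop :=
  IsCosetOf (x 0) (Ahat a) ∧ IsCosetOf (x 2) (Ahat a) ∧ IsCosetOf (x 4) (Ahat a) ∧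
  IsCosetOf (x 1) (Ahat c) ∧ IsCosetOf (x 3) (Ahat c) ∧ IsCosetOf (x 5) (Ahat c) ∧
  x 0 ≠ x 2 ∧ x 0 ≠ x 4 ∧ x 2 ≠ x 4 ∧
  x 1 ≠ x 3 ∧ x 1 ≠ x 5 ∧ x 3 ≠ x 5 ∧
  ∀ i : Fin 6, (x i ∩ x (i + 1)).Nonempty

end D4Artin

namespace D4Artin

/-- The defining relations of the `D₄` Artin monoid. -/
inductive BraidRel : FreeMonoid Gen → FreeMonoid Gen → Prop
  | braid (s : Gen) (hs : s ≠ .d) : BraidRel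
      (FreeMonoid.of s * FreeMonoid.of .d * FreeMonoid.of s)
      (FreeMonoid.of .d * FreeMonoid.of s * FreeMonoid.of .d)
  | comm (s t : Gen) (hs : s ≠ .d) (ht : t ≠ .d) : BraidRel
      (FreeMonoid.of s * FreeMonoid.of t) (FreeMonoid.of t * FreeMonoid.of s)

/-- The Artin monoid of type `D₄`. -/
abbrev ArtinMonoid : Type := PresentedMonoid BraidRel

/-- The generators, as elements of the Artin monoid. -/
def σ (s : Gen) : ArtinMonoid := PresentedMonoid.of BraidRel s

namespace ArtinMonoid

theorem mk_of (s : Gen) : PresentedMonoid.mk BraidRel (FreeMonoid.of s) = σ s := rfl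

theorem braid {s : Gen} (hs : s ≠ .d) : σ s * σ .d * σ s = σ .d * σ s * σ .d :=
  PresentedMonoid.mk_eq_mk_of_rel (BraidRel.braid s hs)

theorem comm {s t : Gen} (hs : s ≠ .d) (ht : t ≠ .d) : σ s * σ t = σ t * σ s :=
  PresentedMonoid.mk_eq_mk_of_rel (BraidRel.comm s t hs ht)

theorem induction {p : ArtinMonoid → Prop} (one : p 1) (mul : ∀ s x, p x → p (σ s * x))
    (x : ArtinMonoid) : p x := by
  induction x using PresentedMonoid.inductionOn with
  | h w =>
    induction w using FreeMonoid.inductionOn' with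
    | one => simpa using one
    | of_mul s w ih => simpa [mk_of] using mul s _ ih

theorem eq_one_or (x : ArtinMonoid) : x = 1 ∨ ∃ s y, x = σ s * y := by
  induction x using induction with
  | one => exact .inl rfl
  | mul s x _ => exact .inr ⟨s, x, rfl⟩

/-- The length of an element of the Artin monoid. -/
def lengthHom : ArtinMonoid →* Multiplicative ℕ :=
  PresentedMonoid.lift (fun _ => .ofAdd 1) (by
    rintro _ _ (⟨s, hs⟩ | ⟨s, t, hs, ht⟩) <;> simp)

/-- The length of an element of the Artin monoid. -/
def len (x : ArtinMonoid) : ℕ := (lengthHom x).toAdd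

@[simp] theorem len_one : len 1 = 0 := by simp [len]

@[simp] theorem len_mul (x y : ArtinMonoid) : len (x * y) = len x + len y := by simp [len]

@[simp] theorem len_σ (s : Gen) : len (σ s) = 1 := by
  simp [len, lengthHom, σ]

theorem len_eq_zero {x : ArtinMonoid} : len x = 0 ↔ x = 1 := by
  refine ⟨fun h => ?_, fun h => by simp [h]⟩
  obtain rfl | ⟨s, y, rfl⟩ := eq_one_or x
  · rfl
  · simp at h

/-- The complement of a generator `s` in a generator `t`: the least common multiple of `s` and `t`
is `s` times this element. -/
def compl (s t : Gen) : ArtinMonoid :=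
  if s = t then 1 else if s = .d ∨ t = .d then σ t * σ s else σ t

@[simp] theorem compl_self (s : Gen) : compl s s = 1 := by simp [compl]

theorem compl_leaves {s t : Gen} (h : s ≠ t) (hs : s ≠ .d) (ht : t ≠ .d) : compl s t = σ t := by
  simp [compl, h, hs, ht]

theorem compl_d_right {s : Gen} (hs : s ≠ .d) : compl s .d = σ .d * σ s := by
  simp [compl, hs]

theorem compl_d_left {s : Gen} (hs : s ≠ .d) : compl .d s = σ s * σ .d := by
  simp [compl, hs.symm]

theorem mul_compl (s t : Gen) : σ s * compl s t = σ t * compl t s := by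
  by_cases h : s = t
  · simp [h]
  by_cases hs : s = .d
  · subst hs
    rw [compl_d_left (Ne.symm h), compl_d_right (Ne.symm h), ← mul_assoc, ← mul_assoc,
      braid (Ne.symm h)]
  by_cases ht : t = .d
  · subst ht
    rw [compl_d_left h, compl_d_right h, ← mul_assoc, ← mul_assoc, braid h]
  rw [compl_leaves h hs ht, compl_leaves (Ne.symm h) ht hs, comm hs ht]

/-- The statement that the common multiples of two generators, up to length `n`, are multiples of
their least common multiple. -/
def LcmUpTo (n : ℕ) : Prop :=
  ∀ s t x y, len x < n → σ s * x = σ t * y → ∃ w, x = compl s t * w ∧ y = compl t s * w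

theorem LcmUpTo.cancel {n : ℕ} (h : LcmUpTo n) {s : Gen} {x y : ArtinMonoid} (hx : len x < n)
    (e : σ s * x = σ s * y) : x = y := by
  obtain ⟨w, rfl, rfl⟩ := h s s x y hx e
  rfl

theorem LcmUpTo.of_leaves {n : ℕ} (h : LcmUpTo n) {s t : Gen} (hst : s ≠ t) (hs : s ≠ .d)
    (ht : t ≠ .d) {x y : ArtinMonoid} (hx : len x < n) (e : σ s * x = σ t * y) :
    ∃ w, x = σ t * w ∧ y = σ s * w := by
  obtain ⟨w, rfl, rfl⟩ := h s t x y hx e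
  exact ⟨w, by rw [compl_leaves hst hs ht], by rw [compl_leaves hst.symm ht hs]⟩

theorem LcmUpTo.of_d {n : ℕ} (h : LcmUpTo n) {s : Gen} (hs : s ≠ .d)
    {x y : ArtinMonoid} (hx : len x < n) (e : σ s * x = σ .d * y) :
    ∃ w, x = σ .d * (σ s * w) ∧ y = σ s * (σ .d * w) := by
  obtain ⟨w, rfl, rfl⟩ := h s .d x y hx e
  exact ⟨w, by rw [compl_d_right hs, mul_assoc], by rw [compl_d_left hs, mul_assoc]⟩

theorem comm' {s t : Gen} (hs : s ≠ .d) (ht : t ≠ .d) (x : ArtinMonoid) :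
    σ s * (σ t * x) = σ t * (σ s * x) := by
  rw [← mul_assoc, comm hs ht, mul_assoc]

theorem braid' {s : Gen} (hs : s ≠ .d) (x : ArtinMonoid) :
    σ s * (σ .d * (σ s * x)) = σ .d * (σ s * (σ .d * x)) := by
  simp only [← mul_assoc, braid hs]

theorem cube_d_mid {n : ℕ} (h : LcmUpTo n) {s t : Gen} (hst : s ≠ t) (hs : s ≠ .d)
    (ht : t ≠ .d) {w₁ w₂ : ArtinMonoid} (hn : len w₁ + 2 ≤ n)
    (e : compl .d s * w₁ = compl .d t * w₂) :
    ∃ w, compl s .d * w₁ = compl s t * w ∧ compl t .d * w₂ = compl t s * w := by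
  simp only [compl_d_left hs, compl_d_left ht, compl_d_right hs, compl_d_right ht,
    compl_leaves hst hs ht, compl_leaves hst.symm ht hs, mul_assoc] at e ⊢
  have hl : len w₁ = len w₂ := by simpa using congrArg len e
  obtain ⟨w₃, e₁, e₂⟩ := h.of_leaves hst hs ht (by simp; omega) e
  have hl₃ : len w₁ = len w₃ := by simpa using congrArg len e₁
  obtain ⟨w₄, rfl, rfl⟩ := h.of_d ht (by omega) e₁.symm
  obtain ⟨w₅, e₃, rfl⟩ := h.of_d hs (by omega) e₂.symm
  simp only [len_mul, len_σ] at *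
  have e₄ := h.cancel (by simp; omega) e₃
  obtain ⟨w₆, rfl, rfl⟩ := h.of_leaves hst.symm ht hs (by omega) e₄
  refine ⟨σ .d * (σ t * (σ s * (σ .d * w₆))), ?_, ?_⟩
  · rw [braid' ht, ← braid' hs, comm' hs ht]
  · rw [comm' ht hs, braid' ht, ← braid' hs, comm' hs ht]

theorem cube_d_left {n : ℕ} (h : LcmUpTo n) {r t : Gen} (hrt : r ≠ t) (hr : r ≠ .d)
    (ht : t ≠ .d) {w₁ w₂ : ArtinMonoid} (hn : len w₁ + 2 ≤ n)
    (e : compl r .d * w₁ = compl r t * w₂) :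
    ∃ w, compl .d r * w₁ = compl .d t * w ∧ compl t r * w₂ = compl t .d * w := by
  simp only [compl_d_right hr, compl_d_right ht, compl_d_left hr, compl_d_left ht,
    compl_leaves hrt hr ht, compl_leaves hrt.symm ht hr, mul_assoc] at e ⊢
  have hl : len w₁ + 1 = len w₂ := by simpa [add_comm] using congrArg len e
  obtain ⟨w₃, rfl, e₁⟩ := h.of_d ht (by omega) e.symm
  simp only [len_mul, len_σ] at *
  obtain ⟨w₄, rfl, e₂⟩ := h.of_leaves hrt hr ht (by omega) e₁
  simp only [len_mul, len_σ] at *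
  obtain ⟨w₅, rfl, rfl⟩ := h.of_d hr (by omega) e₂.symm
  refine ⟨σ r * (σ .d * (σ t * w₅)), ?_, ?_⟩
  · rw [← braid' ht, comm' hr ht, comm' ht hr w₅, braid' hr]
  · rw [comm' ht hr, braid' hr, ← braid' ht, comm' hr ht]

theorem cube_leaves {n : ℕ} (h : LcmUpTo n) {r s t : Gen} (hrs : r ≠ s) (hrt : r ≠ t) (hst : s ≠ t)
    (hr : r ≠ .d) (hs : s ≠ .d) (ht : t ≠ .d) {w₁ w₂ : ArtinMonoid} (hn : len w₁ + 1 ≤ n)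
    (e : compl r s * w₁ = compl r t * w₂) :
    ∃ w, compl s r * w₁ = compl s t * w ∧ compl t r * w₂ = compl t s * w := by
  simp only [compl_leaves, hrs, hrs.symm, hrt, hrt.symm, hst, hst.symm, hr, hs, ht, ne_eq,
    not_false_eq_true] at e ⊢
  obtain ⟨w, rfl, rfl⟩ := h.of_leaves hst hs ht (by omega) e
  exact ⟨σ r * w, comm' hr ht w, comm' hr hs w⟩

theorem LcmUpTo.cube {n : ℕ} (h : LcmUpTo n) (r s t : Gen) {w₁ w₂ : ArtinMonoid}
    (hn : len (compl r s * w₁) ≤ n) (e : compl r s * w₁ = compl r t * w₂) :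
    ∃ w, compl s r * w₁ = compl s t * w ∧ compl t r * w₂ = compl t s * w := by
  by_cases hrs : r = s
  · subst hrs
    exact ⟨w₂, by simpa using e, by simp⟩
  by_cases hrt : r = t
  · subst hrt
    exact ⟨w₁, by simp, by simpa using e.symm⟩
  by_cases hst : s = t
  · subst hst
    have : w₁ = w₂ := by
      by_cases hd : r = .d ∨ s = .d
      · rw [compl, if_neg hrs, if_pos hd] at hn e
        simp only [mul_assoc, len_mul, len_σ] at hn e
        exact h.cancel (by omega) (h.cancel (by simp; omega) e)
      · rw [compl, if_neg hrs, if_neg hd] at hn e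
        simp only [len_mul, len_σ] at hn
        exact h.cancel (by omega) e
    subst this
    exact ⟨compl s r * w₁, by simp, by simp⟩
  by_cases hr : r = .d
  · subst hr
    rw [compl_d_left (Ne.symm hrs)] at hn
    simp only [len_mul, len_σ] at hn
    exact cube_d_mid h hst (Ne.symm hrs) (Ne.symm hrt) (by omega) e
  by_cases hs : s = .d
  · subst hs
    rw [compl_d_right hr] at hn
    simp only [len_mul, len_σ] at hn
    exact cube_d_left h hrt hr (Ne.symm hst) (by omega) e
  by_cases ht : t = .d
  · subst ht
    rw [e, compl_d_right hr] at hn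
    simp only [len_mul, len_σ] at hn
    obtain ⟨w, e₁, e₂⟩ := cube_d_left h hrs hr hs (by omega) e.symm
    exact ⟨w, e₂, e₁⟩
  rw [compl_leaves hrs hr hs] at hn
  simp only [len_mul, len_σ] at hn
  exact cube_leaves h hrs hrt hst hr hs ht (by omega) e

/-- Two words are head-compatible if they are both empty, or if the equality of the elements they
represent comes from the least common multiple of their first letters. -/
def HeadCompat (x y : FreeMonoid Gen) : Prop :=
  (x = 1 ∧ y = 1) ∨ ∃ s t u v w, x = FreeMonoid.of s * u ∧ y = FreeMonoid.of t * v ∧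
    PresentedMonoid.mk BraidRel u = compl s t * w ∧ PresentedMonoid.mk BraidRel v = compl t s * w

theorem HeadCompat.symm {x y : FreeMonoid Gen} : HeadCompat x y → HeadCompat y x := by
  rintro (⟨rfl, rfl⟩ | ⟨s, t, u, v, w, rfl, rfl, hu, hv⟩)
  · exact .inl ⟨rfl, rfl⟩
  · exact .inr ⟨t, s, v, u, w, rfl, rfl, hv, hu⟩

theorem HeadCompat.refl (x : FreeMonoid Gen) : HeadCompat x x := by
  induction x using FreeMonoid.inductionOn' with
  | one => exact .inl ⟨rfl, rfl⟩
  | of_mul s u _ => exact .inr ⟨s, s, u, u, PresentedMonoid.mk BraidRel u, rfl, rfl, by simp, by simp⟩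

theorem of_mul_ne_one (s : Gen) (u : FreeMonoid Gen) : FreeMonoid.of s * u ≠ 1 := fun h => by
  simpa using congrArg FreeMonoid.length h

theorem of_mul_inj {s t : Gen} {u v : FreeMonoid Gen}
    (h : FreeMonoid.of s * u = FreeMonoid.of t * v) : s = t ∧ u = v :=
  List.cons_eq_cons.1 (congrArg FreeMonoid.toList h)

theorem HeadCompat.trans {n : ℕ} (h : LcmUpTo n) {x y z : FreeMonoid Gen}
    (hx : len (PresentedMonoid.mk BraidRel x) ≤ n + 1) (hxy : HeadCompat x y)
    (hyz : HeadCompat y z) : HeadCompat x z := by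
  obtain ⟨rfl, rfl⟩ | ⟨s, r, u, v, w₁, rfl, rfl, hu, hv⟩ := hxy
  · exact hyz
  obtain ⟨h₁, -⟩ | ⟨r', t, v', v₂, w₂, hr, rfl, hv', hv₂⟩ := hyz
  · exact absurd h₁ (of_mul_ne_one _ _)
  obtain ⟨rfl, rfl⟩ := of_mul_inj hr
  have hl : len (compl r s * w₁) ≤ n := by
    have := congrArg len (congrArg (· * w₁) (mul_compl s r))
    simp only [map_mul, mk_of, hu, len_mul, len_σ] at hx this ⊢
    omega
  obtain ⟨w, e₁, e₂⟩ := h.cube r s t hl (hv.symm.trans hv')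
  exact .inr ⟨s, t, u, v₂, w, rfl, rfl, hu.trans e₁, hv₂.trans e₂⟩

theorem headCompat_of_braidRel {x y : FreeMonoid Gen} (h : BraidRel x y) : HeadCompat x y := by
  obtain ⟨s, hs⟩ | ⟨s, t, hs, ht⟩ := h
  · exact .inr ⟨s, .d, FreeMonoid.of .d * FreeMonoid.of s, FreeMonoid.of s * FreeMonoid.of .d, 1,
      by rw [mul_assoc], by rw [mul_assoc], by simp [compl_d_right hs, mk_of],
      by simp [compl_d_left hs, mk_of]⟩
  · by_cases h : s = t
    · subst h
      exact .refl _
    · exact .inr ⟨s, t, FreeMonoid.of t, FreeMonoid.of s, 1, rfl, rfl,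
        by simp [compl_leaves h hs ht, mk_of], by simp [compl_leaves (Ne.symm h) ht hs, mk_of]⟩

theorem headCompat_of_rel {n : ℕ} (h : LcmUpTo n) {x y : FreeMonoid Gen}
    (hxy : ConGen.Rel BraidRel x y) (hx : len (PresentedMonoid.mk BraidRel x) ≤ n + 1) :
    HeadCompat x y := by
  induction hxy with
  | of x y h => exact headCompat_of_braidRel h
  | refl x => exact .refl x
  | symm h' ih =>
    rw [← PresentedMonoid.mk_eq_mk_iff.2 h'] at hx
    exact (ih hx).symm
  | trans h₁ h₂ ih₁ ih₂ =>
    exact (ih₁ hx).trans h hx (ih₂ (by rwa [← PresentedMonoid.mk_eq_mk_iff.2 h₁]))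
  | @mul _ _ y z h₁ h₂ ih₁ ih₂ =>
    rw [map_mul, len_mul] at hx
    obtain ⟨rfl, rfl⟩ | ⟨s, t, u, v, w, rfl, rfl, hu, hv⟩ := ih₁ (by omega)
    · simpa using ih₂ (by omega)
    · have e := PresentedMonoid.mk_eq_mk_iff.2 h₂
      exact .inr ⟨s, t, u * y, v * z, w * PresentedMonoid.mk BraidRel y, mul_assoc _ _ _, mul_assoc _ _ _,
        by rw [map_mul, hu, mul_assoc], by rw [map_mul, hv, e, mul_assoc]⟩

theorem lcmUpTo (n : ℕ) : LcmUpTo n := by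
  induction n with
  | zero => exact fun _ _ _ _ h => absurd h (Nat.not_lt_zero _)
  | succ n ih =>
    intro s t x y hx e
    obtain ⟨u, rfl⟩ := PresentedMonoid.surjective_mk x
    obtain ⟨v, rfl⟩ := PresentedMonoid.surjective_mk y
    have hrel : ConGen.Rel BraidRel (FreeMonoid.of s * u) (FreeMonoid.of t * v) :=
      PresentedMonoid.mk_eq_mk_iff.1 (by simpa [mk_of] using e)
    obtain ⟨h₁, -⟩ | ⟨s', t', u', v', w, hu, hv, e₁, e₂⟩ :=
      headCompat_of_rel ih hrel (by simp [mk_of]; omega)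
    · exact absurd h₁ (of_mul_ne_one _ _)
    · obtain ⟨rfl, rfl⟩ := of_mul_inj hu
      obtain ⟨rfl, rfl⟩ := of_mul_inj hv
      exact ⟨w, e₁, e₂⟩

theorem exists_of_σ_mul_eq {s t : Gen} {x y : ArtinMonoid} (e : σ s * x = σ t * y) :
    ∃ w, x = compl s t * w ∧ y = compl t s * w :=
  lcmUpTo (len x + 1) s t x y (Nat.lt_succ_self _) e

theorem of_leaves {s t : Gen} (hst : s ≠ t) (hs : s ≠ .d) (ht : t ≠ .d) {x y : ArtinMonoid}
    (e : σ s * x = σ t * y) : ∃ w, x = σ t * w ∧ y = σ s * w :=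
  (lcmUpTo (len x + 1)).of_leaves hst hs ht (Nat.lt_succ_self _) e

theorem of_d {s : Gen} (hs : s ≠ .d) {x y : ArtinMonoid} (e : σ s * x = σ .d * y) :
    ∃ w, x = σ .d * (σ s * w) ∧ y = σ s * (σ .d * w) :=
  (lcmUpTo (len x + 1)).of_d hs (Nat.lt_succ_self _) e

instance : IsLeftCancelMul ArtinMonoid where
  mul_left_cancel x y z e := by
    induction x using induction with
    | one => simpa using e
    | mul s x ih =>
      simp only [mul_assoc] at e
      exact ih ((lcmUpTo (len (x * y) + 1)).cancel (Nat.lt_succ_self _) e)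

end ArtinMonoid
end D4Artin

namespace D4Artin
namespace ArtinMonoid

theorem mul_eq_one {x y : ArtinMonoid} : x * y = 1 ↔ x = 1 ∧ y = 1 := by
  simp only [← len_eq_zero, len_mul, Nat.add_eq_zero_iff]

/-! ### Reversal of words -/

/-- Reversal of words, as a homomorphism to the opposite monoid. -/
def revHom : ArtinMonoid →* ArtinMonoidᵐᵒᵖ :=
  PresentedMonoid.lift (fun s => .op (σ s)) (by
    rintro _ _ (⟨s, hs⟩ | ⟨s, t, hs, ht⟩)
    · simp [← MulOpposite.op_mul, ← mul_assoc, braid hs]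
    · simp [← MulOpposite.op_mul, comm ht hs])

/-- Reversal of words. -/
def rev (x : ArtinMonoid) : ArtinMonoid := (revHom x).unop

@[simp] theorem rev_one : rev 1 = 1 := by simp [rev]

@[simp] theorem rev_mul (x y : ArtinMonoid) : rev (x * y) = rev y * rev x := by simp [rev]

@[simp] theorem rev_σ (s : Gen) : rev (σ s) = σ s := by simp [rev, revHom, σ]

@[simp] theorem rev_rev (x : ArtinMonoid) : rev (rev x) = x := by
  induction x using induction with
  | one => simp
  | mul s x ih => simp [ih]

instance : IsRightCancelMul ArtinMonoid where
  mul_right_cancel z x y e := by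
    have := congrArg rev e
    simp only [rev_mul] at this
    simpa using congrArg rev (mul_left_cancel this)

/-! ### Avoiding a generator -/

/-- The homomorphism to `ℕ` sending `t` to `0` and the other generators to `1`. -/
def avoidsHom (t : Gen) : ArtinMonoid →* ℕ :=
  PresentedMonoid.lift (fun s => if s = t then 0 else 1) (by
    rintro _ _ (⟨s, hs⟩ | ⟨s, t, hs, ht⟩)
    · simp only [map_mul, FreeMonoid.lift_eval_of]
      split_ifs <;> rfl
    · simp only [map_mul, FreeMonoid.lift_eval_of, mul_comm])

/-- The words representing `x` do not contain the letter `t`. -/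
def Avoids (t : Gen) (x : ArtinMonoid) : Prop := avoidsHom t x = 1

@[simp] theorem avoids_one (t : Gen) : Avoids t 1 := by simp [Avoids]

@[simp] theorem avoids_mul {t : Gen} {x y : ArtinMonoid} :
    Avoids t (x * y) ↔ Avoids t x ∧ Avoids t y := by simp [Avoids]

@[simp] theorem avoids_σ {t s : Gen} : Avoids t (σ s) ↔ s ≠ t := by
  simp [Avoids, avoidsHom, σ]

@[simp] theorem avoids_rev {t : Gen} {x : ArtinMonoid} : Avoids t (rev x) ↔ Avoids t x := by
  induction x using induction with
  | one => simp
  | mul s x ih => simp [ih, and_comm]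

theorem Avoids.of_dvd {t : Gen} {x y : ArtinMonoid} (hy : Avoids t y) (h : x ∣ y) : Avoids t x := by
  obtain ⟨z, rfl⟩ := h
  exact (avoids_mul.1 hy).1

theorem Avoids.compl {r s t : Gen} (hs : s ≠ r) (ht : t ≠ r) : Avoids r (compl s t) := by
  unfold ArtinMonoid.compl
  split_ifs <;> simp [hs, ht]

/-! ### Least common multiples -/

/-- `x * u = y * v` is the least common right multiple of `x` and `y`. -/
structure IsLcm (x y u v : ArtinMonoid) : Prop where
  eq : x * u = y * v
  univ : ∀ p q, x * p = y * q → ∃ w, p = u * w ∧ q = v * w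
  avoids : ∀ t, Avoids t x → Avoids t y → Avoids t u ∧ Avoids t v

theorem IsLcm.symm {x y u v : ArtinMonoid} (h : IsLcm x y u v) : IsLcm y x v u where
  eq := h.eq.symm
  univ p q e := by
    obtain ⟨w, h₁, h₂⟩ := h.univ q p e.symm
    exact ⟨w, h₂, h₁⟩
  avoids t hy hx := (h.avoids t hx hy).symm

theorem IsLcm.dvd {x y u v z : ArtinMonoid} (h : IsLcm x y u v) (hx : x ∣ z) (hy : y ∣ z) :
    x * u ∣ z := by
  obtain ⟨p, rfl⟩ := hx
  obtain ⟨q, e⟩ := hy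
  obtain ⟨w, rfl, -⟩ := h.univ p q e
  exact ⟨w, (mul_assoc _ _ _).symm⟩

theorem isLcm_one_left (y : ArtinMonoid) : IsLcm 1 y y 1 where
  eq := by simp
  univ p q e := ⟨q, by simpa using e, by simp⟩
  avoids t _ hy := ⟨hy, avoids_one t⟩

theorem exists_isLcm {x y p q : ArtinMonoid} (e : x * p = y * q) : ∃ u v, IsLcm x y u v := by
  induction hn : len (x * p) using Nat.strong_induction_on generalizing x y p q with
  | _ n ih =>
  obtain rfl | ⟨s, x, rfl⟩ := eq_one_or x
  · exact ⟨_, _, isLcm_one_left y⟩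
  obtain rfl | ⟨t, y, rfl⟩ := eq_one_or y
  · exact ⟨_, _, (isLcm_one_left _).symm⟩
  subst hn
  have e' := e
  rw [mul_assoc, mul_assoc] at e'
  obtain ⟨w, e₁, e₂⟩ := exists_of_σ_mul_eq e'
  have l₀ := congrArg len e
  have l₁ := congrArg len e₁
  have l₂ := congrArg len e₂
  simp only [len_mul, len_σ] at l₀ l₁ l₂ ih
  obtain ⟨u₁, v₁, h₁⟩ := ih _ (by omega) e₁ rfl
  obtain ⟨u₂, v₂, h₂⟩ := ih _ (by omega) e₂ rfl
  obtain ⟨p', -, rfl⟩ := h₁.univ _ _ e₁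
  obtain ⟨q', -, e₃⟩ := h₂.univ _ _ e₂
  simp only [len_mul] at l₁
  obtain ⟨u₃, v₃, h₃⟩ := ih (len v₁ + len p') (by omega) e₃ rfl
  refine ⟨u₁ * u₃, u₂ * v₃, ?_, ?_, ?_⟩
  · calc σ s * x * (u₁ * u₃) = σ s * (x * u₁) * u₃ := by simp only [mul_assoc]
      _ = (σ s * compl s t) * (v₁ * u₃) := by rw [h₁.eq]; simp only [mul_assoc]
      _ = σ t * (compl t s * v₂) * v₃ := by rw [mul_compl, h₃.eq]; simp only [mul_assoc]
      _ = σ t * y * (u₂ * v₃) := by rw [← h₂.eq]; simp only [mul_assoc]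
  · intro p q e
    rw [mul_assoc, mul_assoc] at e
    obtain ⟨w, e₁, e₂⟩ := exists_of_σ_mul_eq e
    obtain ⟨p, rfl, rfl⟩ := h₁.univ _ _ e₁
    obtain ⟨q, rfl, e₃⟩ := h₂.univ _ _ e₂
    obtain ⟨w, rfl, rfl⟩ := h₃.univ _ _ e₃
    exact ⟨w, (mul_assoc _ _ _).symm, (mul_assoc _ _ _).symm⟩
  · intro r hx hy
    simp only [avoids_mul, avoids_σ] at hx hy
    obtain ⟨a₁, b₁⟩ := h₁.avoids r hx.2 (.compl hx.1 hy.1)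
    obtain ⟨a₂, b₂⟩ := h₂.avoids r hy.2 (.compl hy.1 hx.1)
    obtain ⟨a₃, b₃⟩ := h₃.avoids r b₁ b₂
    simp [*]

/-! ### Words and braid moves -/

/-- The element represented by a word. -/
def word (l : List Gen) : ArtinMonoid := (l.map σ).prod

@[simp] theorem word_nil : word [] = 1 := rfl

@[simp] theorem word_cons (s : Gen) (l : List Gen) : word (s :: l) = σ s * word l := by
  simp [word]

/-- Apply a braid move at the given position of a word, if possible. -/
def braidMove : ℕ → List Gen → List Gen
  | n + 1, s :: l => s :: braidMove n l
  | 0, [s, t] => if s ≠ .d ∧ t ≠ .d then [t, s] else [s, t]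
  | 0, s :: t :: r :: l =>
    if s ≠ .d ∧ t ≠ .d then t :: s :: r :: l
    else if r = s ∧ (s ≠ .d ∧ t = .d ∨ s = .d ∧ t ≠ .d) then t :: s :: t :: l else s :: t :: r :: l
  | _, l => l

theorem word_braidMove (n : ℕ) (l : List Gen) : word (braidMove n l) = word l := by
  fun_induction braidMove n l
  case case1 ih => simp only [word_cons, ih]
  case case2 h => simp only [word_cons, word_nil, mul_one, comm h.2 h.1]
  case case3 => rfl
  case case4 h => simp only [word_cons, comm' h.2 h.1]
  case case5 h =>
    obtain ⟨rfl, ⟨hs, rfl⟩ | ⟨rfl, ht⟩⟩ := h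
    · simp only [word_cons, braid' hs]
    · simp only [word_cons, braid' ht]
  case case6 => rfl
  case case7 => rfl

theorem word_eq_of_braidMoves (m : List ℕ) {l l' : List Gen} (h : m.foldr braidMove l = l') :
    word l = word l' := by
  subst h
  induction m with
  | nil => rfl
  | cons n m ih => rw [ih, List.foldr_cons, word_braidMove]

theorem σ_dvd_word (m : List ℕ) {l l' : List Gen} {s : Gen} (h : m.foldr braidMove l = s :: l') :
    σ s ∣ word l :=
  ⟨word l', (word_eq_of_braidMoves m h).trans (word_cons s l')⟩

/-! ### The Garside element -/

/-- The central Garside element `(abcd)³`. -/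
def garside : ArtinMonoid :=
  word [.a, .b, .c, .d, .a, .b, .c, .d, .a, .b, .c, .d]

theorem commute_σ_garside (s : Gen) : Commute (σ s) garside := by
  have h : σ s * garside = garside * σ s ↔ word (s :: [.a, .b, .c, .d, .a, .b, .c, .d, .a, .b, .c,
      .d]) = word ([.a, .b, .c, .d, .a, .b, .c, .d, .a, .b, .c, .d] ++ [s]) := by
    simp [word, garside, mul_assoc]
  refine h.2 ?_
  cases s
  · exact word_eq_of_braidMoves [8, 9, 10, 5, 6, 8, 10, 7, 5, 7, 9, 6, 3, 2, 1] (by decide)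
  · exact word_eq_of_braidMoves [9, 10, 4, 5, 6, 8, 10, 7, 5, 7, 6, 3, 5, 2, 0] (by decide)
  · exact word_eq_of_braidMoves [10, 4, 5, 6, 8, 7, 4, 5, 7, 3, 5, 6, 5, 1, 0] (by decide)
  · exact word_eq_of_braidMoves [4, 5, 6, 4, 2, 4, 6, 7, 9, 8, 3, 1, 3, 5, 6, 8, 4, 6, 7, 3, 4, 2, 0, 2, 4, 5, 7, 3, 5, 6, 5] (by decide)

theorem commute_garside (x : ArtinMonoid) : Commute x garside := by
  induction x using induction with
  | one => exact Commute.one_left _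
  | mul s x ih => exact (commute_σ_garside s).mul_left ih

theorem σ_dvd_garside (s : Gen) : σ s ∣ garside := by
  cases s
  · exact ⟨_, word_cons _ _⟩
  · exact σ_dvd_word [0] rfl
  · exact σ_dvd_word [0, 1] rfl
  · exact σ_dvd_word [0, 2, 3, 4, 6, 8, 9, 7, 5, 6, 3, 1, 3, 4, 6, 2, 4, 5, 4] rfl

theorem exists_dvd_garside_pow (x : ArtinMonoid) : ∃ n, x ∣ garside ^ n := by
  induction x using induction with
  | one => exact ⟨0, one_dvd _⟩
  | mul s x ih =>
    obtain ⟨n, y, hy⟩ := ih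
    obtain ⟨z, hz⟩ := σ_dvd_garside s
    refine ⟨n + 1, y * z, ?_⟩
    have e := ((commute_garside (σ s)).pow_right n).eq
    rw [hy] at e
    rw [pow_succ, hy]
    nth_rw 1 [hz]
    rw [← mul_assoc, ← e]
    simp only [mul_assoc]

theorem exists_lcm (x y : ArtinMonoid) : ∃ u v, IsLcm x y u v := by
  obtain ⟨m, x', hx⟩ := exists_dvd_garside_pow x
  obtain ⟨n, y', hy⟩ := exists_dvd_garside_pow y
  refine exists_isLcm (p := x' * garside ^ n) (q := y' * garside ^ m) ?_
  rw [← mul_assoc, ← mul_assoc, ← hx, ← hy, ← pow_add, ← pow_add, add_comm]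

end ArtinMonoid
end D4Artin

namespace D4Artin

theorem gen_braid {s : Gen} (hs : s ≠ .d) :
    gen s * gen .d * gen s = gen .d * gen s * gen .d := by
  have h := PresentedGroup.one_of_mem (rels := Rels) (x := FreeGroup.of s * FreeGroup.of .d *
    FreeGroup.of s * (FreeGroup.of .d * FreeGroup.of s * FreeGroup.of .d)⁻¹)
    ⟨s, .d, hs, .inl ⟨.inr rfl, rfl⟩⟩
  rw [map_mul, map_inv, mul_inv_eq_one] at h
  simp only [map_mul] at h
  exact h

theorem gen_comm {s t : Gen} (hs : s ≠ .d) (ht : t ≠ .d) :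
    gen s * gen t = gen t * gen s := by
  by_cases hst : s = t
  · rw [hst]
  have h := PresentedGroup.one_of_mem (rels := Rels) (x := FreeGroup.of s * FreeGroup.of t *
    (FreeGroup.of s)⁻¹ * (FreeGroup.of t)⁻¹) ⟨s, t, hst, .inr ⟨⟨hs, ht⟩, rfl⟩⟩
  rw [map_mul, map_inv, mul_inv_eq_one, map_mul, map_inv, mul_inv_eq_iff_eq_mul] at h
  simp only [map_mul] at h
  exact h

open ArtinMonoid

/-- The canonical homomorphism from the Artin monoid to the Artin group. -/
def ι : ArtinMonoid →* Artin :=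
  PresentedMonoid.lift gen (by
    rintro _ _ (⟨s, hs⟩ | ⟨s, t, hs, ht⟩)
    · simpa using gen_braid hs
    · simpa using gen_comm hs ht)

@[simp] theorem ι_σ (s : Gen) : ι (σ s) = gen s := by simp [ι, σ]

theorem exists_mul_eq_garside_pow (x : ArtinMonoid) : ∃ y n, y * x = garside ^ n := by
  obtain ⟨n, y, hy⟩ := exists_dvd_garside_pow x
  refine ⟨y, n, mul_left_cancel (a := x) ?_⟩
  rw [← mul_assoc, ← hy, ((commute_garside x).pow_right n).eq]

noncomputable instance : OreLocalization.OreSet (⊤ : Submonoid ArtinMonoid) where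
  ore_right_cancel r₁ r₂ s h := ⟨1, by simpa using mul_right_cancel h⟩
  oreNum r s := r * (exists_mul_eq_garside_pow s).choose
  oreDenom _ s := ⟨garside ^ (exists_mul_eq_garside_pow s).choose_spec.choose, trivial⟩
  ore_eq r s := by
    have h := (exists_mul_eq_garside_pow s).choose_spec.choose_spec
    exact ((commute_garside r).pow_right _).eq.symm.trans
      ((congrArg (r * ·) h.symm).trans (mul_assoc _ _ _).symm)

theorem numeratorHom_injective :
    Function.Injective (OreLocalization.numeratorHom (S := (⊤ : Submonoid ArtinMonoid))) := by
  intro x y h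
  rw [OreLocalization.numeratorHom_apply, OreLocalization.numeratorHom_apply,
    OreLocalization.oreDiv_eq_iff] at h
  obtain ⟨u, v, h₁, h₂⟩ := h
  simp only [OneMemClass.coe_one, mul_one] at h₂
  rw [← h₂] at h₁
  exact (mul_left_cancel h₁).symm

/-- A generator as a unit of the localization of the Artin monoid. -/
noncomputable def locGen (s : Gen) : (OreLocalization (⊤ : Submonoid ArtinMonoid) ArtinMonoid)ˣ :=
  OreLocalization.numeratorUnit (⟨σ s, trivial⟩ : (⊤ : Submonoid ArtinMonoid))

theorem val_locGen (s : Gen) :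
    (locGen s : OreLocalization (⊤ : Submonoid ArtinMonoid) ArtinMonoid) =
      OreLocalization.numeratorHom (σ s) := rfl

/-- The homomorphism from the Artin group to the localization of the Artin monoid. -/
noncomputable def toLoc : Artin →* (OreLocalization (⊤ : Submonoid ArtinMonoid) ArtinMonoid)ˣ :=
  PresentedGroup.toGroup (f := locGen) (by
    rintro _ ⟨s, t, hst, ⟨h, rfl⟩ | ⟨⟨hs, ht⟩, rfl⟩⟩
    · rw [map_mul, map_inv, mul_inv_eq_one]
      ext
      simp only [map_mul, FreeGroup.lift_apply_of, Units.val_mul, val_locGen]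
      simp only [← map_mul]
      obtain rfl | rfl := h
      · rw [braid hst.symm]
      · rw [braid hst]
    · rw [map_mul, map_inv, mul_inv_eq_one, map_mul, map_inv, mul_inv_eq_iff_eq_mul]
      ext
      simp only [map_mul, FreeGroup.lift_apply_of, Units.val_mul, val_locGen]
      simp only [← map_mul]
      rw [comm hs ht])

theorem toLoc_ι (x : ArtinMonoid) :
    (toLoc (ι x) : OreLocalization (⊤ : Submonoid ArtinMonoid) ArtinMonoid) =
      OreLocalization.numeratorHom x := by
  induction x using induction with
  | one => rw [map_one, map_one, map_one, Units.val_one]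
  | mul s x ih =>
    rw [map_mul, map_mul, Units.val_mul, ih, map_mul, ι_σ]
    congr 1
    exact congrArg Units.val (PresentedGroup.toGroup.of _)

theorem ι_injective : Function.Injective ι := fun x y h =>
  numeratorHom_injective (by rw [← toLoc_ι, ← toLoc_ι, h])

theorem commute_ι_garside (g : Artin) : Commute (ι garside) g := by
  induction g using PresentedGroup.induction_on with
  | _ g =>
    induction g using FreeGroup.induction_on with
    | C1 => exact Commute.one_right _
    | of s => 
      have h := ((commute_σ_garside s).map ι).symm
      rw [ι_σ] at h
      exact h
    | inv_of s h => simpa using h.inv_right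
    | mul x y hx hy => rw [map_mul]; exact hx.mul_right hy

theorem exists_garside_pow_mul (g : Artin) : ∃ n x, ι (garside ^ n) * g = ι x := by
  induction g using PresentedGroup.induction_on with
  | _ g =>
    induction g using FreeGroup.induction_on with
    | C1 => exact ⟨0, 1, by simp⟩
    | of s => exact ⟨0, σ s, by simp; rfl⟩
    | inv_of s h =>
      obtain ⟨x, n, hx⟩ := exists_mul_eq_garside_pow (σ s)
      refine ⟨n, x, ?_⟩
      rw [← hx, map_mul, ι_σ, map_inv, mul_assoc]
      exact (congrArg _ (mul_inv_cancel (gen s))).trans (mul_one _)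
    | mul x y hx hy =>
      obtain ⟨m, u, hu⟩ := hx
      obtain ⟨n, v, hv⟩ := hy
      refine ⟨m + n, u * v, ?_⟩
      have e := ((commute_ι_garside (PresentedGroup.mk Rels x)).pow_left n).eq
      rw [map_mul, map_mul, ← hu, ← hv, pow_add, map_mul, map_pow ι _ n, mul_assoc, mul_assoc,
        ← mul_assoc (ι garside ^ n), e]
      simp only [mul_assoc]

end D4Artin

namespace D4Artin
open ArtinMonoid

/-! ### Positive elements of standard parabolic subgroups -/

theorem ι_mem_Ahat_of_avoids {s : Gen} {x : ArtinMonoid} (h : Avoids s x) : ι x ∈ Ahat s := by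
  induction x using induction with
  | one => simp
  | mul t x ih =>
    rw [avoids_mul, avoids_σ] at h
    rw [map_mul, ι_σ]
    exact mul_mem (Subgroup.subset_closure ⟨t, h.1, rfl⟩) (ih h.2)

theorem exists_avoids_of_mem_Ahat {s : Gen} {g : Artin} (h : g ∈ Ahat s) :
    ∃ x y, Avoids s x ∧ Avoids s y ∧ g * ι y = ι x := by
  induction h using Subgroup.closure_induction with
  | mem g h =>
    obtain ⟨t, ht, rfl⟩ := h
    exact ⟨σ t, 1, by simpa using ht, by simp, by simp⟩
  | one => exact ⟨1, 1, by simp⟩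
  | mul g h _ _ hg hh =>
    obtain ⟨x, y, hx, hy, e⟩ := hg
    obtain ⟨x', y', hx', hy', e'⟩ := hh
    obtain ⟨u, v, huv⟩ := exists_lcm y x'
    obtain ⟨hu, hv⟩ := huv.avoids s hy hx'
    refine ⟨x * u, y' * v, by simp [*], by simp [*], ?_⟩
    calc g * h * ι (y' * v) = g * (h * ι y') * ι v := by rw [map_mul]; simp only [mul_assoc]
      _ = g * ι (x' * v) := by rw [e', map_mul, mul_assoc]
      _ = g * ι y * ι u := by rw [← huv.eq, map_mul, mul_assoc]
      _ = ι (x * u) := by rw [e, map_mul]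
  | inv g _ hg =>
    obtain ⟨x, y, hx, hy, e⟩ := hg
    exact ⟨y, x, hy, hx, by rw [← e, inv_mul_cancel_left]⟩

theorem ι_mem_Ahat {s : Gen} {x : ArtinMonoid} : ι x ∈ Ahat s ↔ Avoids s x := by
  refine ⟨fun h => ?_, ι_mem_Ahat_of_avoids⟩
  obtain ⟨u, v, hu, -, e⟩ := exists_avoids_of_mem_Ahat h
  rw [← map_mul] at e
  exact hu.of_dvd ⟨v, (ι_injective e).symm⟩

theorem mem_Ahat_d_commute {g h : Artin} (hg : g ∈ Ahat .d) (hh : h ∈ Ahat .d) : Commute g h := by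
  induction hg using Subgroup.closure_induction with
  | mem g hg =>
    obtain ⟨t, ht, rfl⟩ := hg
    induction hh using Subgroup.closure_induction with
    | mem h hh =>
      obtain ⟨r, hr, rfl⟩ := hh
      exact gen_comm ht hr
    | one => exact Commute.one_right _
    | mul _ _ _ _ h₁ h₂ => exact h₁.mul_right h₂
    | inv _ _ h => exact h.inv_right
  | one => exact Commute.one_left _
  | mul _ _ _ _ h₁ h₂ => exact h₁.mul_left h₂
  | inv _ _ h => exact h.inv_left

theorem exists_mul_of_mem_Ahat_d {s t : Gen} (hst : s ≠ t) {g : Artin} (hg : g ∈ Ahat .d) :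
    ∃ x y, x ∈ Ahat s ∧ y ∈ Ahat t ∧ x ∈ Ahat .d ∧ y ∈ Ahat .d ∧ g = x * y := by
  induction hg using Subgroup.closure_induction with
  | mem g hg =>
    have hg' := Subgroup.subset_closure hg
    obtain ⟨r, hr, rfl⟩ := hg
    by_cases h : r = s
    · exact ⟨1, gen r, one_mem _, Subgroup.subset_closure ⟨r, h ▸ hst, rfl⟩, one_mem _, hg',
        (one_mul _).symm⟩
    · exact ⟨gen r, 1, Subgroup.subset_closure ⟨r, h, rfl⟩, one_mem _, hg', one_mem _,
        (mul_one _).symm⟩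
  | one => exact ⟨1, 1, one_mem _, one_mem _, one_mem _, one_mem _, (mul_one _).symm⟩
  | mul _ _ _ _ h₁ h₂ =>
    obtain ⟨x, y, hx, hy, hx', hy', rfl⟩ := h₁
    obtain ⟨z, w, hz, hw, hz', hw', rfl⟩ := h₂
    exact ⟨x * z, y * w, mul_mem hx hz, mul_mem hy hw, mul_mem hx' hz', mul_mem hy' hw',
      (mem_Ahat_d_commute hy' hz').mul_mul_mul_comm _ _⟩
  | inv _ _ h =>
    obtain ⟨x, y, hx, hy, hx', hy', rfl⟩ := h
    exact ⟨x⁻¹, y⁻¹, inv_mem hx, inv_mem hy, inv_mem hx', inv_mem hy', by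
      rw [mul_inv_rev, (mem_Ahat_d_commute hx' hy').inv_inv.eq]⟩

/-! ### Cosets of standard parabolic subgroups -/

/-- Two subsets of the Artin group intersect. -/
def Meets (X Y : Set Artin) : Prop := (X ∩ Y).Nonempty

theorem Meets.symm {X Y : Set Artin} (h : Meets X Y) : Meets Y X := by
  rwa [Meets, Set.inter_comm]

theorem Meets.of_mem {X Y : Set Artin} {g : Artin} (hX : g ∈ X) (hY : g ∈ Y) : Meets X Y :=
  ⟨g, hX, hY⟩

theorem meets_smul {X Y : Set Artin} {g : Artin} : Meets (g • X) (g • Y) ↔ Meets X Y := by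
  rw [Meets, ← Set.smul_set_inter, Set.smul_set_nonempty, Meets]

variable {X Y W : Set Artin} {s t : Gen}

theorem isCosetOf_smul (g : Artin) (H : Subgroup Artin) : IsCosetOf (g • (H : Set Artin)) H :=
  ⟨g, rfl⟩

theorem IsCosetOf.smul {H : Subgroup Artin} (h : IsCosetOf X H) (g : Artin) :
    IsCosetOf (g • X) H := by
  obtain ⟨k, rfl⟩ := h
  exact ⟨g * k, smul_smul _ _ _⟩

theorem IsCosetOf.nonempty {H : Subgroup Artin} (h : IsCosetOf X H) : X.Nonempty := by
  obtain ⟨g, rfl⟩ := h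
  exact ⟨g, 1, one_mem H, mul_one g⟩

theorem IsCosetOf.mem_iff {H : Subgroup Artin} (h : IsCosetOf X H) {x y : Artin} (hx : x ∈ X) :
    y ∈ X ↔ x⁻¹ * y ∈ H := by
  obtain ⟨g, rfl⟩ := h
  rw [Set.mem_smul_set_iff_inv_smul_mem, smul_eq_mul, SetLike.mem_coe] at hx ⊢
  rw [← H.mul_mem_cancel_left (inv_mem hx)]
  simp [mul_assoc]

theorem IsCosetOf.mul_mem_iff {H : Subgroup Artin} (h : IsCosetOf X H) {x y : Artin} (hx : x ∈ X) :
    x * y ∈ X ↔ y ∈ H := by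
  rw [h.mem_iff hx, inv_mul_cancel_left]

theorem IsCosetOf.eq {H : Subgroup Artin} (hX : IsCosetOf X H) (hY : IsCosetOf Y H)
    (h : Meets X Y) : X = Y := by
  obtain ⟨g, h₁, h₂⟩ := h
  ext x
  rw [hX.mem_iff h₁, hY.mem_iff h₂]

theorem exists_coset (g : Artin) (s : Gen) : ∃ X, IsCosetOf X (Ahat s) ∧ g ∈ X :=
  ⟨_, isCosetOf_smul g _, 1, one_mem _, mul_one g⟩

/-- Cosets of distinct leaf types meeting a common coset of `A_d̂` meet each other. -/
theorem Meets.join (hX : IsCosetOf X (Ahat s)) (hY : IsCosetOf Y (Ahat t))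
    (hW : IsCosetOf W (Ahat .d)) (hst : s ≠ t) (h₁ : Meets X W) (h₂ : Meets Y W) : Meets X Y := by
  obtain ⟨g, hgX, hgW⟩ := h₁
  obtain ⟨h, hhY, hhW⟩ := h₂
  obtain ⟨x, y, hx, hy, -, -, e⟩ := exists_mul_of_mem_Ahat_d hst ((hW.mem_iff hgW).1 hhW)
  refine ⟨g * x, (hX.mul_mem_iff hgX).2 hx, ?_⟩
  rw [show g * x = h * y⁻¹ by rw [eq_mul_inv_iff_mul_eq, mul_assoc, ← e, mul_inv_cancel_left]]
  exact (hY.mul_mem_iff hhY).2 (inv_mem hy)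

/-! ### Positive elements of cosets -/

/-- Every positive element of `X` is left divisible by `s`. -/
def Starts (s : Gen) (X : Set Artin) : Prop := ∀ m, ι m ∈ X → σ s ∣ m

/-- Some positive element of `X` is left divisible by `s`. -/
def Good (s : Gen) (X : Set Artin) : Prop := ∃ m, ι m ∈ X ∧ σ s ∣ m

theorem Starts.good (h : Starts s X) {m : ArtinMonoid} (hX : ι m ∈ X) (hY : ι m ∈ Y) : Good s Y :=
  ⟨m, hY, h m hX⟩

theorem ι_mul_mem_iff (hX : IsCosetOf X (Ahat s)) {p v : ArtinMonoid} (hp : ι p ∈ X) :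
    ι (p * v) ∈ X ↔ Avoids s v := by
  rw [map_mul, hX.mul_mem_iff hp, ι_mem_Ahat]

theorem ι_mem_of_mul (hX : IsCosetOf X (Ahat s)) {p v : ArtinMonoid} (hp : ι (p * v) ∈ X)
    (hv : Avoids s v) : ι p ∈ X := by
  rw [hX.mem_iff hp, map_mul, mul_inv_rev, inv_mul_cancel_right]
  exact inv_mem (ι_mem_Ahat_of_avoids hv)

theorem exists_mul_eq_mul (hX : IsCosetOf X (Ahat s)) {p q : ArtinMonoid} (hp : ι p ∈ X)
    (hq : ι q ∈ X) : ∃ x y, Avoids s x ∧ Avoids s y ∧ p * x = q * y := by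
  obtain ⟨x, y, hx, hy, e⟩ := exists_avoids_of_mem_Ahat ((hX.mem_iff hp).1 hq)
  refine ⟨x, y, hx, hy, ι_injective ?_⟩
  rw [map_mul, map_mul, ← e]
  simp only [mul_assoc, mul_inv_cancel_left]

theorem ArtinMonoid.IsLcm.mem_of_good (hX : IsCosetOf X (Ahat s)) {p u v : ArtinMonoid}
    (h : IsLcm p (σ t) u v) (hp : ι p ∈ X) (ht : Good t X) : ι (p * u) ∈ X := by
  obtain ⟨_, hm, ⟨m, rfl⟩⟩ := ht
  obtain ⟨x, y, hx, -, e⟩ := exists_mul_eq_mul hX hp hm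
  obtain ⟨w, rfl, -⟩ := h.univ x (m * y) (by rw [e, mul_assoc])
  exact (ι_mul_mem_iff hX hp).2 (avoids_mul.1 hx).1

theorem exists_isLcm_rev {x y p q : ArtinMonoid} (e : p * x = q * y) :
    ∃ r u v, p = r * u ∧ q = r * v ∧ u * x = v * y ∧
      ∀ t, Avoids t x → Avoids t y → Avoids t u ∧ Avoids t v := by
  have e' := congrArg rev e
  rw [rev_mul, rev_mul] at e'
  obtain ⟨u, v, h⟩ := exists_isLcm e'
  obtain ⟨w, h₁, h₂⟩ := h.univ _ _ e'
  refine ⟨rev w, rev u, rev v, ?_, ?_, ?_, fun t hx hy => ?_⟩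
  · simpa using congrArg rev h₁
  · simpa using congrArg rev h₂
  · simpa using congrArg rev h.eq
  · simpa using h.avoids t (by simpa using hx) (by simpa using hy)

/-- `ξ` is the minimal positive element of `X`. -/
structure IsMinRep (ξ : ArtinMonoid) (X : Set Artin) : Prop where
  mem : ι ξ ∈ X
  dvd : ∀ m, ι m ∈ X → ξ ∣ m

theorem exists_isMinRep (hX : IsCosetOf X (Ahat s)) {m : ArtinMonoid} (hm : ι m ∈ X) :
    ∃ ξ, IsMinRep ξ X := by
  classical
  have hex : ∃ n ξ, ι ξ ∈ X ∧ len ξ = n := ⟨_, m, hm, rfl⟩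
  obtain ⟨ξ, hξ, hn⟩ := Nat.find_spec hex
  refine ⟨ξ, hξ, fun m hm => ?_⟩
  obtain ⟨x, y, hx, hy, e⟩ := exists_mul_eq_mul hX hξ hm
  obtain ⟨r, u, v, rfl, rfl, -, h⟩ := exists_isLcm_rev e
  have hr := ι_mem_of_mul hX hξ (h s hx hy).1
  have hl := Nat.find_min' hex ⟨r, hr, rfl⟩
  rw [← hn, len_mul] at hl
  rw [len_eq_zero.1 (show len u = 0 by omega), mul_one]
  exact dvd_mul_right _ _

theorem IsMinRep.starts_iff {ξ : ArtinMonoid} (h : IsMinRep ξ X) : Starts s X ↔ σ s ∣ ξ :=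
  ⟨fun hs => hs _ h.mem, fun hs m hm => hs.trans (h.dvd m hm)⟩

theorem IsMinRep.eq_one_or {ξ : ArtinMonoid} (h : IsMinRep ξ X) : ξ = 1 ∨ ∃ s, Starts s X := by
  obtain rfl | ⟨s, y, rfl⟩ := ArtinMonoid.eq_one_or ξ
  · exact .inl rfl
  · exact .inr ⟨s, h.starts_iff.2 (dvd_mul_right _ _)⟩

theorem one_mem_or_starts (hX : IsCosetOf X (Ahat s)) {m : ArtinMonoid} (hm : ι m ∈ X) :
    ι 1 ∈ X ∨ ∃ t, Starts t X := by
  obtain ⟨ξ, hξ⟩ := exists_isMinRep hX hm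
  obtain rfl | h := hξ.eq_one_or
  · exact .inl hξ.mem
  · exact .inr h

/-- The minimal positive element of a coset of `A_ŝ` ends only in `s`. -/
theorem IsMinRep.eq_of_mul_σ {ξ : ArtinMonoid} (hX : IsCosetOf X (Ahat s)) (h : IsMinRep ξ X)
    {x : ArtinMonoid} (e : ξ = x * σ t) : t = s := by
  by_contra hts
  have hx : ι x ∈ X := ι_mem_of_mul hX (e ▸ h.mem) (avoids_σ.2 hts)
  obtain ⟨y, hy⟩ := h.dvd _ hx
  have h₁ := congrArg len hy
  rw [e] at h₁
  simp only [len_mul, len_σ] at h₁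
  omega

end D4Artin

namespace D4Artin
open ArtinMonoid

/-! ### Normalization -/

/-- A family of cosets is normalized if intersecting members have a common positive element, and
no generator which divides all the positive elements of a member can be moved out of all the
members simultaneously. -/
structure IsNormalized (S : Set (Set Artin)) : Prop where
  common : ∀ X ∈ S, ∀ Y ∈ S, Meets X Y → ∃ m, ι m ∈ X ∧ ι m ∈ Y
  blocked : ∀ X ∈ S, ∀ s, Starts s X → ∃ Y ∈ S, ¬ Good s Y

theorem exists_normalized_of_common {S : Set (Set Artin)}
    (hS : ∀ X ∈ S, ∃ s, IsCosetOf X (Ahat s)) (L : ArtinMonoid) (g : Artin)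
    (hL : ∀ X ∈ S, ∃ m, m ∣ L ∧ ι m ∈ g • X)
    (hP : ∀ X ∈ S, ∀ Y ∈ S, Meets X Y → ∃ m, ι m ∈ g • X ∧ ι m ∈ g • Y) :
    ∃ g : Artin, IsNormalized ((g • ·) '' S) := by
  induction hn : len L using Nat.strong_induction_on generalizing L g with
  | _ n ih =>
  subst hn
  by_cases hT : ∀ X ∈ S, ∀ s, Starts s (g • X) → ∃ Y ∈ S, ¬ Good s (g • Y)
  · refine ⟨g, ?_, ?_⟩
    · rintro _ ⟨X, hX, rfl⟩ _ ⟨Y, hY, rfl⟩ h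
      exact hP X hX Y hY (meets_smul.1 h)
    · rintro _ ⟨X, hX, rfl⟩ s hs
      obtain ⟨Y, hY, h⟩ := hT X hX s hs
      exact ⟨_, ⟨Y, hY, rfl⟩, h⟩
  push Not at hT
  obtain ⟨X₀, hX₀, s, hs, hgood⟩ := hT
  obtain ⟨m₀, hm₀, hmem₀⟩ := hL X₀ hX₀
  obtain ⟨L, rfl⟩ := (hs m₀ hmem₀).trans hm₀
  have key : ∀ (X : Set Artin) (r : ArtinMonoid), ι (σ s * r) ∈ g • X → ι r ∈ ((ι (σ s))⁻¹ * g) • X := by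
    intro X r h
    rwa [← smul_smul, Set.mem_smul_set_iff_inv_smul_mem, inv_inv, smul_eq_mul, ← map_mul]
  refine ih (len L) (by simp) L ((ι (σ s))⁻¹ * g) (fun X hX => ?_) (fun X hX Y hY h => ?_) rfl
  · obtain ⟨t, ht⟩ := hS X hX
    obtain ⟨m, hm, hmem⟩ := hL X hX
    obtain ⟨u, v, h⟩ := exists_lcm m (σ s)
    have hd := h.dvd hm (dvd_mul_right _ _)
    have := h.mem_of_good (ht.smul g) hmem (hgood X hX)
    rw [h.eq] at this hd
    obtain ⟨z, hz⟩ := hd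
    rw [mul_assoc] at hz
    exact ⟨v, ⟨z, mul_left_cancel hz⟩, key X v this⟩
  · obtain ⟨t, ht⟩ := hS X hX
    obtain ⟨t', ht'⟩ := hS Y hY
    obtain ⟨m, hmX, hmY⟩ := hP X hX Y hY h
    obtain ⟨u, v, h⟩ := exists_lcm m (σ s)
    have h₁ := h.mem_of_good (ht.smul g) hmX (hgood X hX)
    have h₂ := h.mem_of_good (ht'.smul g) hmY (hgood Y hY)
    rw [h.eq] at h₁ h₂
    exact ⟨v, key X v h₁, key Y v h₂⟩

theorem exists_garside_pow_mul_of_le {g : Artin} {n x} (h : ι (garside ^ n) * g = ι x) {N : ℕ}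
    (hN : n ≤ N) : ∃ y, ι (garside ^ N) * g = ι y := by
  obtain ⟨k, rfl⟩ := Nat.exists_eq_add_of_le' hN
  exact ⟨garside ^ k * x, by rw [pow_add, map_mul, mul_assoc, h, map_mul]⟩

theorem exists_garside_pow_mul_range {I : Type*} [Finite I] (f : I → Artin) :
    ∃ N, ∀ i, ∃ x, ι (garside ^ N) * f i = ι x := by
  have := Fintype.ofFinite I
  choose n x h using fun i => exists_garside_pow_mul (f i)
  exact ⟨Finset.univ.sup n, fun i =>
    exists_garside_pow_mul_of_le (h i) (Finset.le_sup (Finset.mem_univ i))⟩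

theorem exists_common_multiple {I : Type*} [Finite I] (f : I → ArtinMonoid) :
    ∃ L, ∀ i, f i ∣ L := by
  have := Fintype.ofFinite I
  choose n h using fun i => exists_dvd_garside_pow (f i)
  exact ⟨garside ^ Finset.univ.sup n, fun i =>
    (h i).trans (pow_dvd_pow _ (Finset.le_sup (Finset.mem_univ i)))⟩

theorem exists_normalized {S : Set (Set Artin)} (hfin : S.Finite)
    (hS : ∀ X ∈ S, ∃ s, IsCosetOf X (Ahat s)) : ∃ g : Artin, IsNormalized ((g • ·) '' S) := by
  classical
  have := hfin.to_subtype
  have hpt : ∀ i : S × S, ∃ g, Meets i.1.1 i.2.1 → g ∈ i.1.1 ∩ i.2.1 := fun i => by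
    by_cases h : Meets i.1.1 i.2.1
    · exact ⟨h.some, fun _ => h.some_mem⟩
    · exact ⟨1, fun h' => absurd h' h⟩
  choose f hf using hpt
  obtain ⟨N, hN⟩ := exists_garside_pow_mul_range f
  choose m hm using hN
  obtain ⟨L, hL⟩ := exists_common_multiple m
  have key : ∀ i, Meets i.1.1 i.2.1 →
      ι (m i) ∈ ι (garside ^ N) • i.1.1 ∧ ι (m i) ∈ ι (garside ^ N) • i.2.1 := fun i h => by
    rw [← hm i]
    exact ⟨Set.smul_mem_smul_set (hf i h).1, Set.smul_mem_smul_set (hf i h).2⟩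
  refine exists_normalized_of_common hS L (ι (garside ^ N)) (fun X hX => ?_)
    (fun X hX Y hY h => ⟨m (⟨X, hX⟩, ⟨Y, hY⟩), key (⟨X, hX⟩, ⟨Y, hY⟩) h⟩)
  obtain ⟨s, hs⟩ := hS X hX
  refine ⟨m (⟨X, hX⟩, ⟨X, hX⟩), hL _, (key (⟨X, hX⟩, ⟨X, hX⟩) ?_).1⟩
  rw [Meets, Set.inter_self]
  exact hs.nonempty

/-! ### Divisibility lemmas -/

variable {r s t : Gen} {x y : ArtinMonoid}

theorem mul_dvd_of_leaf_dvd_d (hs : s ≠ .d) (h : σ s ∣ σ .d * y) : σ s * σ .d ∣ y := by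
  obtain ⟨x, e⟩ := h
  obtain ⟨w, -, rfl⟩ := of_d hs e.symm
  exact ⟨w, (mul_assoc _ _ _).symm⟩

theorem mul_dvd_of_d_dvd_leaf (hs : s ≠ .d) (h : σ .d ∣ σ s * y) : σ .d * σ s ∣ y := by
  obtain ⟨x, e⟩ := h
  obtain ⟨w, rfl, -⟩ := of_d hs e
  exact ⟨w, (mul_assoc _ _ _).symm⟩

theorem dvd_of_leaf_dvd_leaf (hs : s ≠ .d) (ht : t ≠ .d) (hst : s ≠ t) (h : σ s ∣ σ t * y) :
    σ s ∣ y := by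
  obtain ⟨x, e⟩ := h
  obtain ⟨w, rfl, -⟩ := of_leaves hst.symm ht hs e
  exact ⟨w, rfl⟩

theorem mul_mul_dvd_of_leaf (hs : s ≠ .d) (ht : t ≠ .d) (hst : s ≠ t)
    (h : σ s * σ .d ∣ σ t * y) : σ s * σ .d * σ t ∣ y := by
  obtain ⟨x, e⟩ := h
  rw [mul_assoc] at e
  obtain ⟨w, rfl, e'⟩ := of_leaves hst.symm ht hs e
  obtain ⟨v, rfl, -⟩ := of_d ht e'.symm
  exact ⟨v, by simp only [mul_assoc]⟩

theorem mul_dvd_of_ne (hs : s ≠ .d) (hr : r ≠ s) (h : σ s * σ .d ∣ σ r * y) :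
    σ s * σ .d ∣ y := by
  by_cases hd : r = .d
  · subst hd
    exact mul_dvd_of_leaf_dvd_d hs ((dvd_mul_right _ _).trans h)
  · exact (dvd_mul_right _ _).trans (mul_mul_dvd_of_leaf hs hd hr.symm h)

theorem mul_mul_dvd_of_ne (hs : s ≠ .d) (ht : t ≠ .d) (hst : s ≠ t) (hr : r ≠ s)
    (h : σ s * σ .d * σ t ∣ σ r * y) : σ s * σ .d * σ t ∣ y := by
  by_cases hrt : r = t
  · subst hrt
    exact mul_mul_dvd_of_leaf hs ht hst ((dvd_mul_right _ _).trans h)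
  obtain ⟨x, e⟩ := h
  simp only [mul_assoc] at e
  by_cases hd : r = .d
  · subst hd
    obtain ⟨w, e', rfl⟩ := of_d hs e.symm
    obtain ⟨v, -, rfl⟩ := of_leaves hst.symm ht hs (mul_left_cancel e')
    exact ⟨v, by simp only [mul_assoc]⟩
  · obtain ⟨w, rfl, e'⟩ := of_leaves hr hd hs e
    obtain ⟨v, rfl, e''⟩ := of_d hd e'.symm
    obtain ⟨u, -, e₃⟩ := of_leaves (Ne.symm hrt) ht hd e''
    obtain ⟨k, -, rfl⟩ := of_d ht e₃.symm
    exact ⟨σ r * (σ .d * k), by simp only [mul_assoc, comm' hd ht]⟩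

theorem mul_dvd_of_leaf (hs : s ≠ .d) (ht : t ≠ .d) (h : σ .d * σ s ∣ σ t * y) :
    σ .d * σ s ∣ y := by
  by_cases hst : t = s
  · subst hst
    exact mul_dvd_of_d_dvd_leaf ht ((dvd_mul_right _ _).trans h)
  obtain ⟨x, e⟩ := h
  rw [mul_assoc] at e
  obtain ⟨w, rfl, e'⟩ := of_d ht e
  obtain ⟨v, -, e''⟩ := of_leaves (Ne.symm hst) hs ht e'
  obtain ⟨u, -, rfl⟩ := of_d hs e''.symm
  exact ⟨σ t * (σ .d * u), by simp only [mul_assoc, comm' ht hs]⟩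

theorem dvd_of_dvd_mul_avoids {p : ArtinMonoid} (hp : ∀ r, r ≠ s → ∀ y, p ∣ σ r * y → p ∣ y)
    {w u : ArtinMonoid} (hw : Avoids s w) (h : p ∣ w * u) : p ∣ u := by
  induction w using induction with
  | one => simpa using h
  | mul r w ih =>
    rw [avoids_mul, avoids_σ] at hw
    exact ih hw.2 (hp r hw.1 _ (by rwa [← mul_assoc]))

theorem not_dvd_of_avoids (h : Avoids s y) : ¬ σ s ∣ y := fun hs => by
  simpa using h.of_dvd hs

theorem avoids_of_mul_dvd (hs : s ≠ .d) (ht : t ≠ .d) (hst : s ≠ t) {w u : ArtinMonoid}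
    (hw : Avoids s w) (hu : Avoids t u) (h : σ s * σ .d ∣ w * u) : Avoids t w := by
  induction w using induction with
  | one => simp
  | mul r w ih =>
    rw [avoids_mul, avoids_σ] at hw ⊢
    rw [mul_assoc] at h
    refine ⟨?_, ih hw.2 (mul_dvd_of_ne hs hw.1 h)⟩
    rintro rfl
    have := dvd_of_dvd_mul_avoids (fun r hr y => mul_mul_dvd_of_ne hs ht hst hr) hw.2
      (mul_mul_dvd_of_leaf hs ht hst h)
    simpa using hu.of_dvd this

theorem exists_mul_of_leaf_dvd (hs : s ≠ .d) (hst : t ≠ s) {w u : ArtinMonoid}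
    (hw : Avoids s w) (hu : Avoids t u) (h : σ s ∣ w * u) :
    ∃ v m, w = v * m ∧ Avoids .d v ∧ Avoids t m := by
  induction w using induction with
  | one => exact ⟨1, 1, by simp⟩
  | mul r w ih =>
    rw [avoids_mul, avoids_σ] at hw
    rw [mul_assoc] at h
    by_cases hr : r = .d
    · subst hr
      have hsd := mul_dvd_of_leaf_dvd_d hs h
      by_cases ht : t = .d
      · subst ht
        have := dvd_of_dvd_mul_avoids (fun r hr y => mul_dvd_of_ne hs hr) hw.2 hsd
        simpa using hu.of_dvd this
      · exact ⟨1, _, (one_mul _).symm, avoids_one _, avoids_mul.2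
          ⟨avoids_σ.2 (Ne.symm ht), avoids_of_mul_dvd hs ht hst.symm hw.2 hu hsd⟩⟩
    · obtain ⟨v, m, rfl, hv, hm⟩ := ih hw.2 (dvd_of_leaf_dvd_leaf hs hr hw.1.symm h)
      exact ⟨σ r * v, m, (mul_assoc _ _ _).symm, avoids_mul.2 ⟨avoids_σ.2 hr, hv⟩, hm⟩

theorem avoids_of_d_dvd (ht : t ≠ .d) {w u : ArtinMonoid}
    (hw : Avoids .d w) (hu : Avoids t u) (h : σ .d ∣ w * u) : Avoids t w := by
  induction w using induction with
  | one => simp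
  | mul r w ih =>
    rw [avoids_mul, avoids_σ] at hw ⊢
    rw [mul_assoc] at h
    have hd := mul_dvd_of_d_dvd_leaf hw.1 h
    refine ⟨?_, ih hw.2 ((dvd_mul_right _ _).trans hd)⟩
    rintro rfl
    have := dvd_of_dvd_mul_avoids (fun r hr y => mul_dvd_of_leaf ht hr) hw.2 hd
    simpa using hu.of_dvd this

theorem exists_prefix_of_not_avoids {l : ArtinMonoid} (h : ¬ Avoids s l) :
    ∃ l₁ l₂, l = l₁ * (σ s * l₂) ∧ Avoids s l₁ := by
  induction l using induction with
  | one => simp at h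
  | mul r l ih =>
    by_cases hr : r = s
    · subst hr
      exact ⟨1, l, (one_mul _).symm, avoids_one _⟩
    · obtain ⟨l₁, l₂, rfl, h₁⟩ := ih (fun h' => h (avoids_mul.2 ⟨avoids_σ.2 hr, h'⟩))
      exact ⟨σ r * l₁, l₂, (mul_assoc _ _ _).symm, avoids_mul.2 ⟨avoids_σ.2 hr, h₁⟩⟩

/-! ### Gates -/

/-- A point that every coset `X` meeting `Y`, in which `t` is good, comes close to, provided that
`t` is not good in `Y`. -/
theorem exists_gate {Y : Set Artin} {y : ArtinMonoid} (hY : IsCosetOf Y (Ahat s))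
    (hy : IsMinRep y Y) (ht : ¬ Good t Y) :
    ∃ q, ι q ∈ Y ∧ ∀ X r, IsCosetOf X (Ahat r) → (∃ m, ι m ∈ X ∧ ι m ∈ Y) → Good t X →
      ∃ u k, Avoids s u ∧ Avoids r k ∧ σ s ∣ u * k ∧ ι (q * u) ∈ X := by
  obtain ⟨l, m, hl⟩ := exists_lcm y (σ t)
  have hnl : ¬ Avoids s l := fun h =>
    ht ⟨y * l, (ι_mul_mem_iff hY hy.mem).2 h, m, hl.eq⟩
  obtain ⟨l₁, l₂, rfl, hl₁⟩ := exists_prefix_of_not_avoids hnl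
  refine ⟨y * l₁, (ι_mul_mem_iff hY hy.mem).2 hl₁, fun X r hX ⟨p, hpX, hpY⟩ hgood => ?_⟩
  obtain ⟨w, rfl⟩ := hy.dvd p hpY
  have hw := (ι_mul_mem_iff hY hy.mem).1 hpY
  obtain ⟨α, β, hα⟩ := exists_lcm (y * w) (σ t)
  have hαX := (ι_mul_mem_iff hX hpX).1 (hα.mem_of_good hX hpX hgood)
  obtain ⟨k, hk, -⟩ := hl.univ (w * α) β (by rw [← mul_assoc, hα.eq])
  obtain ⟨w₁, u₁, hw₁⟩ := exists_lcm w l₁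
  obtain ⟨κ, rfl, hκ⟩ := hw₁.univ α (σ s * l₂ * k) (by rw [hk, mul_assoc])
  rw [avoids_mul] at hαX
  refine ⟨u₁, κ, (hw₁.avoids s hw hl₁).2, hαX.2, ⟨l₂ * k, by rw [← hκ, mul_assoc]⟩, ?_⟩
  rw [mul_assoc, ← hw₁.eq, ← mul_assoc]
  exact (ι_mul_mem_iff hX hpX).2 hαX.1

theorem exists_leaf_gate {Y : Set Artin} (hY : IsCosetOf Y (Ahat s)) (hs : s ≠ .d)
    {p : ArtinMonoid} (hp : ι p ∈ Y) (ht : ¬ Good t Y) :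
    ∃ W, IsCosetOf W (Ahat .d) ∧ Meets Y W ∧ ∀ X r, IsCosetOf X (Ahat r) → r ≠ s →
      (∃ m, ι m ∈ X ∧ ι m ∈ Y) → Good t X → Meets X W := by
  obtain ⟨y, hy⟩ := exists_isMinRep hY hp
  obtain ⟨q, hq, h⟩ := exists_gate hY hy ht
  obtain ⟨W, hW, hqW⟩ := exists_coset (ι q) .d
  refine ⟨W, hW, .of_mem hq hqW, fun X r hX hr hXY hgood => ?_⟩
  obtain ⟨u, k, hu, hk, hd, hX'⟩ := h X r hX hXY hgood
  obtain ⟨v, m, rfl, hv, hm⟩ := exists_mul_of_leaf_dvd hs hr hu hk hd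
  rw [← mul_assoc] at hX'
  exact .of_mem (ι_mem_of_mul hX hX' hm) ((ι_mul_mem_iff hW hqW).2 hv)

theorem exists_d_gate {Y : Set Artin} (hY : IsCosetOf Y (Ahat .d))
    {p : ArtinMonoid} (hp : ι p ∈ Y) (ht : ¬ Good t Y) :
    ∃ q, ι q ∈ Y ∧ ∀ X r, IsCosetOf X (Ahat r) → r ≠ .d →
      (∃ m, ι m ∈ X ∧ ι m ∈ Y) → Good t X → ι q ∈ X := by
  obtain ⟨y, hy⟩ := exists_isMinRep hY hp
  obtain ⟨q, hq, h⟩ := exists_gate hY hy ht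
  refine ⟨q, hq, fun X r hX hr hXY hgood => ?_⟩
  obtain ⟨u, k, hu, hk, hd, hX'⟩ := h X r hX hXY hgood
  exact ι_mem_of_mul hX hX' (avoids_of_d_dvd hr hu hk hd)

end D4Artin

namespace D4Artin
open ArtinMonoid

variable {r s t : Gen} {x y : ArtinMonoid} {X Y : Set Artin}

theorem commute_σ_of_avoids_d (hs : s ≠ .d) (hx : Avoids .d x) : Commute (σ s) x := by
  induction x using induction with
  | one => exact Commute.one_right _
  | mul t x ih =>
    rw [avoids_mul, avoids_σ] at hx
    exact Commute.mul_right (comm hs hx.1) (ih hx.2)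

theorem exists_eq_mul_σ (hs : s ≠ .d) (hx : Avoids .d x) (h : ¬ Avoids s x) :
    ∃ y, x = σ s * y ∧ x = y * σ s := by
  obtain ⟨l₁, l₂, rfl, -⟩ := exists_prefix_of_not_avoids h
  simp only [avoids_mul] at hx
  have h₁ := (commute_σ_of_avoids_d hs hx.1).eq
  have h₂ := (commute_σ_of_avoids_d hs hx.2.2).eq
  exact ⟨l₁ * l₂, by rw [← mul_assoc, ← h₁, mul_assoc], by rw [h₂, mul_assoc]⟩

theorem IsMinRep.avoids_of_avoids_d (hX : IsCosetOf X (Ahat s)) (h : IsMinRep x X)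
    (hx : Avoids .d x) (ht : t ≠ .d) (hts : t ≠ s) : Avoids t x := by
  by_contra hn
  obtain ⟨y, -, hy⟩ := exists_eq_mul_σ ht hx hn
  exact hts (h.eq_of_mul_σ hX hy)

theorem ArtinMonoid.IsLcm.of_univ {u v : ArtinMonoid} (e : x * u = y * v)
    (h : ∀ p q, x * p = y * q → ∃ w, p = u * w ∧ q = v * w) : IsLcm x y u v := by
  obtain ⟨u', v', h'⟩ := exists_isLcm e
  obtain ⟨w, hu, hv⟩ := h u' v' h'.eq
  obtain ⟨w', hu', hv'⟩ := h'.univ u v e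
  have hw : w = 1 := by
    rw [hu', mul_assoc, left_eq_mul] at hu
    exact (mul_eq_one.1 hu).2
  rw [hw, mul_one] at hu hv
  rwa [hu, hv] at h'

theorem ArtinMonoid.IsLcm.cancel {u v z : ArtinMonoid} (h : IsLcm (z * x) (z * y) u v) :
    IsLcm x y u v :=
  .of_univ (mul_left_cancel (by simpa only [mul_assoc] using h.eq)) fun p q e =>
    h.univ p q (by rw [mul_assoc, e, mul_assoc])

theorem eq_one_of_avoids (h : ∀ s, Avoids s x) : x = 1 := by
  obtain rfl | ⟨s, y, rfl⟩ := eq_one_or x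
  · rfl
  · simpa using h s

theorem dvd_of_leaf_dvd_mul (hs : s ≠ .d) {u : ArtinMonoid} (hu : Avoids .d u) (hus : Avoids s u)
    (h : σ s ∣ u * y) : σ s ∣ y := by
  induction u using induction with
  | one => simpa using h
  | mul r u ih =>
    rw [avoids_mul, avoids_σ] at hu hus
    exact ih hu.2 hus.2 (dvd_of_leaf_dvd_leaf hs hu.1 hus.1.symm (by rwa [← mul_assoc]))

theorem isLcm_trichotomy {w u α δ : ArtinMonoid} (h : IsLcm w u α δ)
    (hwa : Avoids .a w) (hwc : Avoids .c w) (huc : Avoids .c u) (hud : Avoids .d u)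
    (hαb : ¬ σ .b ∣ α) (hαd : ¬ σ .d ∣ α) (hδb : ¬ σ .b ∣ δ) :
    (Avoids .b α ∧ Avoids .b δ) ∨ α = 1 ∨ σ .a * σ .d * σ .b ∣ α := by
  induction hn : len w using Nat.strong_induction_on generalizing w u with
  | _ n ih =>
  subst hn
  by_cases hbu : Avoids .b u
  · have hbw : ¬ σ .b ∣ w := fun hbw => hδb <|
      dvd_of_leaf_dvd_mul (by decide) hud hbu (h.eq ▸ hbw.trans (dvd_mul_right _ _))
    by_cases hwb : Avoids .b w
    · exact .inl (h.avoids .b hwb hbu)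
    obtain ⟨w₁, w₂, rfl, hw₁⟩ := exists_prefix_of_not_avoids hwb
    obtain rfl | ⟨s, w₁, rfl⟩ := eq_one_or w₁
    · exact absurd ⟨w₂, one_mul _⟩ hbw
    obtain rfl | ⟨t, u, rfl⟩ := eq_one_or u
    · obtain ⟨k, hk, -⟩ := h.univ 1 _ ((mul_one _).trans (one_mul _).symm)
      exact .inr (.inl (mul_eq_one.1 hk.symm).1)
    simp only [avoids_mul, avoids_σ] at hwa hwc hw₁ huc hud hbu
    obtain rfl : s = .d := by cases s <;> simp_all
    obtain rfl : t = .a := by cases t <;> simp_all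
    have h₁ : σ .a ∣ σ .d * (w₁ * (σ .b * (w₂ * α))) :=
      ⟨u * δ, by simpa only [mul_assoc] using h.eq⟩
    have h₂ := dvd_of_dvd_mul_avoids (fun r hr y => mul_dvd_of_ne (by decide) hr) hwa.1.2
      (mul_dvd_of_leaf_dvd_d (by decide) h₁)
    exact .inr (.inr (dvd_of_dvd_mul_avoids
      (fun r hr y => mul_mul_dvd_of_ne (by decide) (by decide) (by decide) hr) hwa.2.2
      (mul_mul_dvd_of_leaf (by decide) (by decide) (by decide) h₂)))
  · obtain ⟨u, rfl, -⟩ := exists_eq_mul_σ (by decide) hud hbu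
    simp only [avoids_mul] at huc hud
    by_cases hbw : σ .b ∣ w
    · obtain ⟨w, rfl⟩ := hbw
      simp only [avoids_mul] at hwa hwc
      exact ih (len w) (by simp) h.cancel hwa.2 hwc.2 huc.2 hud.2 rfl
    · exfalso
      obtain ⟨m, n, hm⟩ := exists_isLcm (h.eq.trans (mul_assoc _ _ _))
      obtain ⟨k, rfl, -⟩ := hm.univ _ _ (h.eq.trans (mul_assoc _ _ _))
      obtain rfl | ⟨s, m, rfl⟩ := eq_one_or m
      · exact hbw ⟨n, by simpa using hm.eq⟩
      have ha := (hm.avoids .a hwa (by simp)).1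
      have hc := (hm.avoids .c hwc (by simp)).1
      cases s
      · simp at ha
      · exact hαb ⟨m * k, mul_assoc _ _ _⟩
      · simp at hc
      · exact hαd ⟨m * k, mul_assoc _ _ _⟩

end D4Artin

namespace D4Artin
open ArtinMonoid

variable {s t : Gen} {x y : ArtinMonoid} {X Y : Set Artin}

/-- The Garside element of the parabolic submonoid generated by `a, b, d`. -/
def garsideABD : ArtinMonoid := word [.b, .d, .a, .b, .d, .b]

theorem exists_mul_garsideABD (hx : Avoids .c x) : ∃ y, x * garsideABD = garsideABD * y := by
  induction x using induction with
  | one => exact ⟨1, by simp⟩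
  | mul s x ih =>
    rw [avoids_mul, avoids_σ] at hx
    obtain ⟨y, hy⟩ := ih hx.2
    have key : ∀ t : Gen, word [s, .b, .d, .a, .b, .d, .b] = word [.b, .d, .a, .b, .d, .b, t] →
        ∃ y, σ s * x * garsideABD = garsideABD * y := fun t ht => by
      refine ⟨σ t * y, ?_⟩
      have : σ s * garsideABD = garsideABD * σ t := by
        simpa only [garsideABD, word_cons, word_nil, mul_one, mul_assoc] using ht
      rw [mul_assoc, hy, ← mul_assoc, this, mul_assoc]
    cases s
    · exact key .b (word_eq_of_braidMoves [3, 1, 0] (by decide))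
    · exact key .a (word_eq_of_braidMoves [5, 2, 3, 1, 3] (by decide))
    · exact absurd rfl hx.1
    · exact key .d (word_eq_of_braidMoves [4, 2, 0] (by decide))

theorem σ_dvd_garsideABD (ht : t ≠ .c) : σ t ∣ garsideABD := by
  cases t
  · exact σ_dvd_word [0, 1, 3] rfl
  · exact σ_dvd_word [] rfl
  · exact absurd rfl ht
  · exact σ_dvd_word [0, 2] rfl

theorem avoids_b_of_disjoint_starts {A D : Set Artin} {α δ m : ArtinMonoid}
    (hA : IsCosetOf A (Ahat .a)) (hD : IsCosetOf D (Ahat .d)) (hα : IsMinRep α A)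
    (hδ : IsMinRep δ D) (hmA : ι m ∈ A) (hmD : ι m ∈ D) (hαc : Avoids .c α) (hδc : Avoids .c δ)
    (hdisj : ∀ s, σ s ∣ α → ¬ σ s ∣ δ) (hα1 : α ≠ 1) (ht : t ≠ .c) (hAt : ¬ Good t A) :
    Avoids .b α ∧ Avoids .b δ := by
  obtain ⟨w₀, rfl⟩ := hα.dvd m hmA
  obtain ⟨u₀, hu₀⟩ := hδ.dvd _ hmD
  obtain ⟨w, u, h⟩ := exists_isLcm hu₀
  obtain ⟨k, rfl, rfl⟩ := h.univ _ _ hu₀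
  have hwa := (avoids_mul.1 ((ι_mul_mem_iff hA hα.mem).1 hmA)).1
  have hud := (avoids_mul.1 ((ι_mul_mem_iff hD hδ.mem).1 (hu₀ ▸ hmD))).1
  obtain ⟨hwc, huc⟩ := h.avoids .c hαc hδc
  have e : rev w * rev α = rev u * rev δ := by rw [← rev_mul, h.eq, rev_mul]
  obtain ⟨p, q, hpq⟩ := exists_isLcm e
  obtain ⟨z, hp, hq⟩ := hpq.univ _ _ e
  have hz : z = 1 := by
    rw [← rev_rev z]
    obtain hz | ⟨s, y, hz⟩ := eq_one_or (rev z)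
    · rw [hz, rev_one]
    · exact absurd (show σ s ∣ δ by rw [← rev_rev δ, hq, rev_mul, hz, mul_assoc]; exact ⟨_, rfl⟩)
        (hdisj s (by rw [← rev_rev α, hp, rev_mul, hz, mul_assoc]; exact ⟨_, rfl⟩))
  rw [hz, mul_one] at hp hq
  rw [← hp, ← hq] at hpq
  have hends : ∀ {X : Set Artin} {r s : Gen} {ξ : ArtinMonoid}, IsCosetOf X (Ahat r) →
      IsMinRep ξ X → s ≠ r → ¬ σ s ∣ rev ξ := fun {_ _ _ ξ} hX hξ hs ⟨y, hy⟩ =>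
    hs (hξ.eq_of_mul_σ hX (x := rev y) (by rw [← rev_rev ξ, hy]; simp))
  obtain hb | h1 | ⟨z, hz⟩ := isLcm_trichotomy hpq (avoids_rev.2 hwa) (avoids_rev.2 hwc)
    (avoids_rev.2 huc) (avoids_rev.2 hud) (hends hA hα (by decide)) (hends hA hα (by decide))
    (hends hD hδ (by decide))
  · simpa only [avoids_rev] using hb
  · exact absurd (by rw [← rev_rev α, h1, rev_one]) hα1
  · exfalso
    have hz' : α = rev z * (σ .b * (σ .d * σ .a)) := by
      rw [← rev_rev α, hz]; simp [mul_assoc]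
    obtain ⟨y, hy⟩ := exists_mul_garsideABD (x := rev z)
      (by rw [hz', avoids_mul] at hαc; exact hαc.1)
    refine hAt ⟨α * (σ .b * (σ .d * σ .b)), (ι_mul_mem_iff hA hα.mem).2 (by simp), ?_⟩
    have : α * (σ .b * (σ .d * σ .b)) = garsideABD * y := by
      rw [← hy, hz']; simp [garsideABD, mul_assoc]
    exact this ▸ (σ_dvd_garsideABD ht).mul_right _

end D4Artin

namespace D4Artin
open ArtinMonoid

variable {r s t : Gen} {x y : ArtinMonoid} {X Y W : Set Artin} {S : Set (Set Artin)}

theorem IsCosetOf.meets_self {H : Subgroup Artin} (h : IsCosetOf X H) : Meets X X :=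
  let ⟨_, hg⟩ := h.nonempty
  .of_mem hg hg

theorem meets_inv_smul {g : Artin} : Meets X (g⁻¹ • W) ↔ Meets (g • X) W := by
  rw [← meets_smul (g := g), smul_inv_smul]

theorem Meets.comm : Meets X Y ↔ Meets Y X := ⟨.symm, .symm⟩

/-! ### Squares -/

theorem IsNormalized.exists_leaf_gate_pair {T : Set (Set Artin)} {A B : Set Artin}
    (hN : IsNormalized (insert A (insert B T))) (hs : s ≠ .d)
    (hA : IsCosetOf A (Ahat s)) (hB : IsCosetOf B (Ahat s)) (hAB : A ≠ B)
    (hT : ∀ X ∈ T, (∃ r, r ≠ s ∧ IsCosetOf X (Ahat r)) ∧ Meets X A ∧ Meets X B) :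
    ∃ W, IsCosetOf W (Ahat .d) ∧ (Meets W A ∨ Meets W B) ∧ ∀ X ∈ T, Meets X W := by
  have key : ∀ {A B : Set Artin}, IsNormalized (insert A (insert B T)) → IsCosetOf A (Ahat s) →
      IsCosetOf B (Ahat s) →
      (∀ X ∈ T, (∃ r, r ≠ s ∧ IsCosetOf X (Ahat r)) ∧ Meets X A ∧ Meets X B) →
      ∀ t, Starts t A → ∃ W, IsCosetOf W (Ahat .d) ∧ Meets W B ∧ ∀ X ∈ T, Meets X W := by
    intro A B hN hA hB hT t ht
    have hgood : ∀ X ∈ T, Good t X := fun X hX => by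
      obtain ⟨m, hm, hm'⟩ := hN.common X (by simp [hX]) A (by simp) (hT X hX).2.1
      exact ht.good hm' hm
    have hBt : ¬ Good t B := by
      obtain ⟨Y, rfl | rfl | hY, h⟩ := hN.blocked A (by simp) t ht
      · obtain ⟨m, hm, -⟩ := hN.common Y (by simp) Y (by simp) hA.meets_self
        exact absurd (ht.good hm hm) h
      · exact h
      · exact absurd (hgood Y hY) h
    obtain ⟨m, hm, -⟩ := hN.common B (by simp) B (by simp) hB.meets_self
    obtain ⟨W, hW, hBW, h⟩ := exists_leaf_gate hB hs hm hBt
    refine ⟨W, hW, hBW.symm, fun X hX => ?_⟩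
    obtain ⟨⟨r, hr, hXr⟩, -, hXB⟩ := hT X hX
    exact h X r hXr hr (hN.common X (by simp [hX]) B (by simp) hXB) (hgood X hX)
  obtain ⟨m, hm, -⟩ := hN.common A (by simp) A (by simp) hA.meets_self
  obtain ⟨n, hn, -⟩ := hN.common B (by simp) B (by simp) hB.meets_self
  obtain h | ⟨t, ht⟩ := one_mem_or_starts hA hm
  · obtain h' | ⟨t, ht⟩ := one_mem_or_starts hB hn
    · exact absurd (hA.eq hB (.of_mem h h')) hAB
    · obtain ⟨W, hW, h₁, h₂⟩ := key (by rwa [Set.insert_comm]) hB hA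
        (fun X hX => ⟨(hT X hX).1, (hT X hX).2.symm⟩) t ht
      exact ⟨W, hW, .inl h₁, h₂⟩
  · obtain ⟨W, hW, h₁, h₂⟩ := key hN hA hB hT t ht
    exact ⟨W, hW, .inr h₁, h₂⟩

theorem exists_leaf_gate_pair {A B : Set Artin} (hs : s ≠ .d)
    (hA : IsCosetOf A (Ahat s)) (hB : IsCosetOf B (Ahat s)) (hAB : A ≠ B)
    (hX : IsCosetOf X (Ahat r)) (hr : r ≠ s) (hY : IsCosetOf Y (Ahat t)) (ht : t ≠ s)
    (hXA : Meets X A) (hXB : Meets X B) (hYA : Meets Y A) (hYB : Meets Y B) :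
    ∃ W, IsCosetOf W (Ahat .d) ∧ (Meets W A ∨ Meets W B) ∧ Meets X W ∧ Meets Y W := by
  obtain ⟨g, hg⟩ := exists_normalized (S := {A, B, X, Y}) (by simp) (by
    rintro Z (rfl | rfl | rfl | rfl)
    exacts [⟨_, hA⟩, ⟨_, hB⟩, ⟨_, hX⟩, ⟨_, hY⟩])
  rw [Set.image_insert_eq, Set.image_insert_eq] at hg
  obtain ⟨W, hW, h, h'⟩ := hg.exists_leaf_gate_pair hs (hA.smul g) (hB.smul g)
    (fun h => hAB (smul_left_cancel g h)) (by
      rintro _ ⟨Z, rfl | rfl, rfl⟩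
      exacts [⟨⟨r, hr, hX.smul g⟩, meets_smul.2 hXA, meets_smul.2 hXB⟩,
        ⟨⟨t, ht, hY.smul g⟩, meets_smul.2 hYA, meets_smul.2 hYB⟩])
  refine ⟨g⁻¹ • W, hW.smul _, ?_⟩
  simp only [meets_inv_smul, Meets.comm (X := g⁻¹ • W)]
  exact ⟨h.imp .symm .symm, h' _ ⟨X, by simp⟩, h' _ ⟨Y, by simp⟩⟩

/-- A coset of `A_d̂` meeting two cosets of the same leaf type meets all the cosets that do. -/
theorem meets_of_meets_pair {A B D : Set Artin} (hs : s ≠ .d)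
    (hA : IsCosetOf A (Ahat s)) (hB : IsCosetOf B (Ahat s)) (hAB : A ≠ B)
    (hD : IsCosetOf D (Ahat .d)) (hDA : Meets D A) (hDB : Meets D B)
    (hX : IsCosetOf X (Ahat r)) (hr : r ≠ s) (hXA : Meets X A) (hXB : Meets X B) :
    Meets X D := by
  obtain ⟨W, hW, -, hDW, hXW⟩ := exists_leaf_gate_pair hs hA hB hAB hD hs.symm hX hr hDA hDB hXA hXB
  rwa [hD.eq hW hDW]

theorem meets_of_square {A B : Set Artin} (hs : s ≠ .d)
    (hA : IsCosetOf A (Ahat s)) (hB : IsCosetOf B (Ahat s)) (hAB : A ≠ B)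
    (hX : IsCosetOf X (Ahat r)) (hr : r ≠ s) (hY : IsCosetOf Y (Ahat t)) (ht : t ≠ s) (hrt : r ≠ t)
    (hXA : Meets X A) (hXB : Meets X B) (hYA : Meets Y A) (hYB : Meets Y B) : Meets X Y := by
  obtain ⟨W, hW, -, hXW, hYW⟩ := exists_leaf_gate_pair hs hA hB hAB hX hr hY ht hXA hXB hYA hYB
  exact .join hX hY hW hrt hXW hYW

theorem exists_center {A B : Set Artin} (hs : s ≠ .d) (hr : r ≠ .d) (hrs : r ≠ s)
    (hA : IsCosetOf A (Ahat s)) (hB : IsCosetOf B (Ahat s)) (hAB : A ≠ B)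
    (hX : IsCosetOf X (Ahat r)) (hY : IsCosetOf Y (Ahat r)) (hXY : X ≠ Y)
    (hXA : Meets X A) (hXB : Meets X B) (hYA : Meets Y A) (hYB : Meets Y B) :
    ∃ W, IsCosetOf W (Ahat .d) ∧ Meets W A ∧ Meets W B ∧ Meets W X ∧ Meets W Y := by
  obtain ⟨W, hW, -, hXW, hYW⟩ :=
    exists_leaf_gate_pair hs hA hB hAB hX hrs hY hrs hXA hXB hYA hYB
  exact ⟨W, hW, (meets_of_meets_pair hr hX hY hXY hW hXW.symm hYW.symm hA hrs.symm hXA.symm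
    hYA.symm).symm, (meets_of_meets_pair hr hX hY hXY hW hXW.symm hYW.symm hB hrs.symm hXB.symm
    hYB.symm).symm, hXW.symm, hYW.symm⟩

end D4Artin

namespace D4Artin
open ArtinMonoid

/-! ### Triangles -/

/-- A triangle of cosets `A i` of `A_â` with sides `D i` which are cosets of `A_d̂`, all meeting
a coset `X` of `A_ĉ`. -/
structure Triangle (X : Set Artin) (A D : Fin 3 → Set Artin) : Prop where
  isCosetOf_X : IsCosetOf X (Ahat .c)
  isCosetOf_A : ∀ i, IsCosetOf (A i) (Ahat .a)
  isCosetOf_D : ∀ i, IsCosetOf (D i) (Ahat .d)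
  injective : Function.Injective A
  meets : ∀ i j, i ≠ j → Meets (D i) (A j)
  meets_A : ∀ i, Meets X (A i)
  meets_D : ∀ i, Meets X (D i)

/-- A normalized triangle in which no side meets the opposite corner. -/
structure Triangle.Reduced (X : Set Artin) (A D : Fin 3 → Set Artin) : Prop
    extends Triangle X A D where
  not_meets : ∀ i, ¬ Meets (D i) (A i)
  normalized : IsNormalized (insert X (Set.range A ∪ Set.range D))

variable {r s t : Gen} {X : Set Artin} {A D : Fin 3 → Set Artin} {i j k : Fin 3}
  {α δ : ArtinMonoid}

theorem exists_ne_ne (i j : Fin 3) : ∃ k, k ≠ i ∧ k ≠ j := by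
  revert i j; decide

namespace Triangle.Reduced

variable (h : Triangle.Reduced X A D)
include h

theorem common_X_A (i : Fin 3) : ∃ m, ι m ∈ X ∧ ι m ∈ A i :=
  h.normalized.common _ (by simp) _ (by simp) (h.meets_A i)

theorem common_X_D (i : Fin 3) : ∃ m, ι m ∈ X ∧ ι m ∈ D i :=
  h.normalized.common _ (by simp) _ (by simp) (h.meets_D i)

theorem common_D_A (hij : i ≠ j) : ∃ m, ι m ∈ D i ∧ ι m ∈ A j :=
  h.normalized.common _ (by simp) _ (by simp) (h.meets i j hij)

theorem good_self_A (hs : Starts s (A i)) : Good s (A i) :=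
  let ⟨_, _, hm⟩ := h.common_X_A i
  hs.good hm hm

theorem good_self_D (hs : Starts s (D i)) : Good s (D i) :=
  let ⟨_, _, hm⟩ := h.common_X_D i
  hs.good hm hm

theorem good_D (hs : Starts s (A j)) (hij : i ≠ j) : Good s (D i) :=
  let ⟨_, hm, hm'⟩ := h.common_D_A hij
  hs.good hm' hm

theorem good_A (hs : Starts s (D i)) (hij : i ≠ j) : Good s (A j) :=
  let ⟨_, hm, hm'⟩ := h.common_D_A hij
  hs.good hm hm'

theorem exists_blocked {Y : Set Artin} (hY : Y ∈ insert X (Set.range A ∪ Set.range D))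
    (hs : Starts s Y) (hX : Good s X) : (∃ i, ¬ Good s (A i)) ∨ ∃ i, ¬ Good s (D i) := by
  obtain ⟨Z, rfl | ⟨i, rfl⟩ | ⟨i, rfl⟩, hZ⟩ := h.normalized.blocked Y hY s hs
  exacts [absurd hX hZ, .inl ⟨i, hZ⟩, .inr ⟨i, hZ⟩]

theorem one_mem_X : ι 1 ∈ X := by
  obtain ⟨m, hm, -⟩ := h.common_X_A 0
  refine (one_mem_or_starts h.isCosetOf_X hm).resolve_right fun ⟨s, hs⟩ => ?_
  obtain ⟨i, hi⟩ | ⟨i, hi⟩ := h.exists_blocked (by simp) hs (hs.good hm hm)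
  · obtain ⟨n, hn, hn'⟩ := h.common_X_A i
    exact hi (hs.good hn hn')
  · obtain ⟨n, hn, hn'⟩ := h.common_X_D i
    exact hi (hs.good hn hn')

theorem exists_isMinRep_A (i : Fin 3) : ∃ α, IsMinRep α (A i) ∧ Avoids .c α := by
  obtain ⟨m, hm, hm'⟩ := h.common_X_A i
  obtain ⟨α, hα⟩ := exists_isMinRep (h.isCosetOf_A i) hm'
  have hmc := (ι_mul_mem_iff h.isCosetOf_X h.one_mem_X).1 ((one_mul m).symm ▸ hm)
  exact ⟨α, hα, hmc.of_dvd (hα.dvd m hm')⟩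

theorem exists_isMinRep_D (i : Fin 3) : ∃ δ, IsMinRep δ (D i) ∧ Avoids .c δ := by
  obtain ⟨m, hm, hm'⟩ := h.common_X_D i
  obtain ⟨δ, hδ⟩ := exists_isMinRep (h.isCosetOf_D i) hm'
  have hmc := (ι_mul_mem_iff h.isCosetOf_X h.one_mem_X).1 ((one_mul m).symm ▸ hm)
  exact ⟨δ, hδ, hmc.of_dvd (hδ.dvd m hm')⟩

theorem ne_c_of_starts_A (hs : Starts s (A i)) : s ≠ .c := by
  obtain ⟨α, hα, hc⟩ := h.exists_isMinRep_A i
  rintro rfl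
  exact not_dvd_of_avoids hc (hα.starts_iff.1 hs)

theorem ne_c_of_starts_D (hs : Starts s (D i)) : s ≠ .c := by
  obtain ⟨δ, hδ, hc⟩ := h.exists_isMinRep_D i
  rintro rfl
  exact not_dvd_of_avoids hc (hδ.starts_iff.1 hs)

theorem exists_starts_A (h1 : ι 1 ∉ A i) : ∃ s, Starts s (A i) :=
  let ⟨_, _, hm⟩ := h.common_X_A i
  (one_mem_or_starts (h.isCosetOf_A i) hm).resolve_left h1

theorem exists_starts_D (h1 : ι 1 ∉ D i) : ∃ s, Starts s (D i) :=
  let ⟨_, _, hm⟩ := h.common_X_D i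
  (one_mem_or_starts (h.isCosetOf_D i) hm).resolve_left h1

theorem not_good_D (hs : Starts s (A i)) : ¬ Good s (D i) := by
  intro hg
  obtain ⟨m, hm, hm'⟩ := h.common_X_A i
  obtain ⟨j, hj⟩ | ⟨j, hj⟩ := h.exists_blocked (by simp) hs (hs.good hm' hm)
  · obtain rfl | hij := eq_or_ne i j
    · exact hj (h.good_self_A hs)
    obtain ⟨k, hki, hkj⟩ := exists_ne_ne i j
    obtain ⟨n, -, hn⟩ := h.common_X_A j
    obtain ⟨W, hW, -, hW'⟩ := exists_leaf_gate (h.isCosetOf_A j) (by decide) hn hj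
    have h₁ := hW' _ _ (h.isCosetOf_D i) (by decide) (h.common_D_A hij) hg
    have h₂ := hW' _ _ (h.isCosetOf_D k) (by decide) (h.common_D_A hkj) (h.good_D hs hki)
    have e := ((h.isCosetOf_D k).eq hW h₂).trans ((h.isCosetOf_D i).eq hW h₁).symm
    exact h.not_meets i (e ▸ h.meets k i hki)
  · obtain rfl | hij := eq_or_ne i j
    · exact hj hg
    · exact hj (h.good_D hs hij.symm)

theorem not_good_A (hs : Starts s (D i)) : ¬ Good s (A i) := by
  intro hg
  obtain ⟨m, hm, hm'⟩ := h.common_X_D i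
  obtain ⟨j, hj⟩ | ⟨j, hj⟩ := h.exists_blocked (by simp) hs (hs.good hm' hm)
  · obtain rfl | hij := eq_or_ne i j
    · exact hj hg
    · exact hj (h.good_A hs hij)
  · obtain rfl | hij := eq_or_ne i j
    · exact hj (h.good_self_D hs)
    obtain ⟨k, hki, hkj⟩ := exists_ne_ne i j
    obtain ⟨n, -, hn⟩ := h.common_X_D j
    obtain ⟨q, -, hq⟩ := exists_d_gate (h.isCosetOf_D j) hn hj
    have hcomm : ∀ {l}, j ≠ l → ∃ m, ι m ∈ A l ∧ ι m ∈ D j := fun hl =>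
      let ⟨m, hm, hm'⟩ := h.common_D_A hl
      ⟨m, hm', hm⟩
    have h₁ := hq _ _ (h.isCosetOf_A i) (by decide) (hcomm hij.symm) hg
    have h₂ := hq _ _ (h.isCosetOf_A k) (by decide) (hcomm hkj.symm) (h.good_A hs hki.symm)
    exact hki (h.injective ((h.isCosetOf_A k).eq (h.isCosetOf_A i) (.of_mem h₂ h₁)))

theorem eq_of_starts_A (hi : Starts s (A i)) (hj : Starts s (A j)) : i = j := by
  by_contra hij
  exact h.not_good_D hj (h.good_D hi (Ne.symm hij))

theorem eq_of_starts_D (hi : Starts s (D i)) (hj : Starts s (D j)) : i = j := by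
  by_contra hij
  exact h.not_good_A hj (h.good_A hi hij)

theorem avoids_b (hij : i ≠ j) (hα : IsMinRep α (A i)) (hδ : IsMinRep δ (D j))
    (hdisj : ∀ s, Starts s (A i) → ¬ Starts s (D j)) (h1 : ι 1 ∉ A i) (ht : t ≠ .c)
    (hAt : ¬ Good t (A i)) : Avoids .b α ∧ Avoids .b δ := by
  obtain ⟨m, hmD, hmA⟩ := h.common_D_A hij.symm
  obtain ⟨α', hα', hαc⟩ := h.exists_isMinRep_A i
  obtain ⟨δ', hδ', hδc⟩ := h.exists_isMinRep_D j
  refine avoids_b_of_disjoint_starts (h.isCosetOf_A i) (h.isCosetOf_D j) hα hδ hmA hmD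
    (hαc.of_dvd (hα.dvd _ hα'.mem)) (hδc.of_dvd (hδ.dvd _ hδ'.mem))
    (fun s hs hs' => hdisj s (hα.starts_iff.2 hs) (hδ.starts_iff.2 hs')) ?_ ht hAt
  rintro rfl
  exact h1 hα.mem

theorem avoids_d_of_one_mem (hij : i ≠ j) (h1 : ι 1 ∈ D i) (hα : IsMinRep α (A j)) :
    Avoids .d α := by
  obtain ⟨m, hmD, hmA⟩ := h.common_D_A hij
  exact ((ι_mul_mem_iff (h.isCosetOf_D i) h1).1 ((one_mul m).symm ▸ hmD)).of_dvd (hα.dvd m hmA)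

theorem avoids_a_of_one_mem (hij : i ≠ j) (h1 : ι 1 ∈ A j) (hδ : IsMinRep δ (D i)) :
    Avoids .a δ := by
  obtain ⟨m, hmD, hmA⟩ := h.common_D_A hij
  exact ((ι_mul_mem_iff (h.isCosetOf_A j) h1).1 ((one_mul m).symm ▸ hmA)).of_dvd (hδ.dvd m hmD)

theorem avoids_leaf_of_one_mem (hij : i ≠ j) (h1 : ι 1 ∈ D i) (hα : IsMinRep α (A j))
    (ht : t ≠ .a) : Avoids t α := by
  have hd := h.avoids_d_of_one_mem hij h1 hα
  by_cases htd : t = .d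
  · exact htd ▸ hd
  · exact hα.avoids_of_avoids_d (h.isCosetOf_A j) hd htd ht

theorem exists_one_mem : ∃ k, ι 1 ∈ A k := by
  by_contra! hA
  have hD : ∀ i, ι 1 ∉ D i := fun i h1 => by
    have key : ∀ j, i ≠ j → Starts .a (A j) := fun j hij => by
      obtain ⟨α, hα, -⟩ := h.exists_isMinRep_A j
      obtain ⟨s, hs⟩ := h.exists_starts_A (hA j)
      obtain rfl : s = .a := by
        by_contra hsa
        exact not_dvd_of_avoids (h.avoids_leaf_of_one_mem hij h1 hα hsa) (hα.starts_iff.1 hs)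
      exact hs
    obtain ⟨j, hji, -⟩ := exists_ne_ne i i
    obtain ⟨k, hki, hkj⟩ := exists_ne_ne i j
    exact hkj (h.eq_of_starts_A (key k hki.symm) (key j hji.symm))
  choose s hs using fun i => h.exists_starts_A (hA i)
  have hsc := fun i => h.ne_c_of_starts_A (hs i)
  have hsi : Function.Injective s := fun i j e => h.eq_of_starts_A (hs i) (e ▸ hs j)
  have habd : ∀ x y z : Gen, x ≠ .c → y ≠ .c → z ≠ .c → x ≠ y → x ≠ z → y ≠ z →
      x = .b ∨ y = .b ∨ z = .b := by
    intro x y z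
    cases x <;> cases y <;> cases z <;> simp
  obtain ⟨j, hj⟩ : ∃ j, s j = .b := by
    obtain hb | hb | hb := habd _ _ _ (hsc 0) (hsc 1) (hsc 2) (hsi.ne (by decide))
      (hsi.ne (by decide)) (hsi.ne (by decide))
    exacts [⟨_, hb⟩, ⟨_, hb⟩, ⟨_, hb⟩]
  have hjb : Starts .b (A j) := hj ▸ hs j
  obtain ⟨i, hij, -⟩ := exists_ne_ne j j
  obtain ⟨k, hkj, hki⟩ := exists_ne_ne j i
  have hSj : ∀ t, Starts t (A j) → t = .b := fun t ht => by
    have hne : ∀ l, l ≠ j → t ≠ s l := fun l hl e => hl (h.eq_of_starts_A (hs l) (e ▸ ht))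
    obtain hb | hb | hb := habd _ _ _ (h.ne_c_of_starts_A ht) (hsc i) (hsc k) (hne i hij)
      (hne k hkj) (hsi.ne hki.symm)
    · exact hb
    · exact absurd (hsi (hb.trans hj.symm)) hij
    · exact absurd (hsi (hb.trans hj.symm)) hkj
  obtain ⟨l, hlj, hlb⟩ : ∃ l, l ≠ j ∧ ¬ Starts .b (D l) := by
    by_contra! hl
    exact hki (h.eq_of_starts_D (hl k hkj) (hl i hij))
  obtain ⟨r, hr⟩ := h.exists_starts_D (hD j)
  obtain ⟨α, hα, -⟩ := h.exists_isMinRep_A j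
  obtain ⟨δ, hδ, -⟩ := h.exists_isMinRep_D l
  exact not_dvd_of_avoids (h.avoids_b hlj.symm hα hδ (fun t ht => hSj t ht ▸ hlb) (hA j)
    (h.ne_c_of_starts_D hr) (h.not_good_A hr)).1 (hα.starts_iff.1 hjb)

end Triangle.Reduced

end D4Artin

namespace D4Artin
open ArtinMonoid

variable {r s t : Gen} {x y : ArtinMonoid}

theorem avoids_pow {n : ℕ} (h : s ≠ t) : Avoids t (σ s ^ n) := by
  induction n with
  | zero => simp
  | succ n ih => simp [pow_succ, ih, h]

theorem exists_eq_mul_pow (hc : Avoids .c x) (hd : Avoids .d x) :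
    ∃ u n, x = u * σ .a ^ n ∧ Avoids .a u := by
  induction x using induction with
  | one => exact ⟨1, 0, by simp⟩
  | mul s x ih =>
    rw [avoids_mul, avoids_σ] at hc hd
    obtain ⟨u, n, rfl, hu⟩ := ih hc.2 hd.2
    by_cases hs : s = .a
    · subst hs
      refine ⟨u, n + 1, ?_, hu⟩
      rw [← mul_assoc, (commute_σ_of_avoids_d (by decide) (avoids_mul.1 hd.2).1).eq, mul_assoc,
        pow_succ']
    · exact ⟨σ s * u, n, (mul_assoc _ _ _).symm, avoids_mul.2 ⟨avoids_σ.2 hs, hu⟩⟩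

theorem exists_mul_pow_of_mul_pow_eq {z : ArtinMonoid} {m n : ℕ} (e : x * z ^ m = y * z ^ n) :
    ∃ l, x = y * z ^ l ∨ y = x * z ^ l := by
  obtain h | h := le_total m n
  · obtain ⟨l, rfl⟩ := Nat.exists_eq_add_of_le' h
    rw [pow_add, ← mul_assoc] at e
    exact ⟨l, .inl (mul_right_cancel e)⟩
  · obtain ⟨l, rfl⟩ := Nat.exists_eq_add_of_le' h
    rw [pow_add, ← mul_assoc] at e
    exact ⟨l, .inr (mul_right_cancel e).symm⟩

/-- Moving a power of `a` past the unique letter `d`. -/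
theorem exists_eq_mul_of_d_mul_a_dvd {w : ArtinMonoid} {l : ℕ} (ha : Avoids .a w) (hc : Avoids .c w)
    (h : σ .d * σ .a ∣ w * σ .a ^ l) : ∃ v, w * σ .a ^ l = σ .d * σ .a ^ l * v ∧ Avoids .a v := by
  have hda : ∀ r, r ≠ .d → ∀ y, σ .d * σ .a ∣ σ r * y → σ .d * σ .a ∣ y := fun r hr y =>
    mul_dvd_of_leaf (by decide) hr
  have hdw : ¬ Avoids .d w := fun hd =>
    not_dvd_of_avoids (s := .d) (avoids_pow (by decide))
      ((dvd_mul_right _ _).trans (dvd_of_dvd_mul_avoids hda hd h))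
  obtain ⟨w₁, w₂, rfl, hw₁⟩ := exists_prefix_of_not_avoids hdw
  simp only [avoids_mul, mul_assoc] at ha hc h
  obtain ⟨p, hp⟩ := dvd_of_dvd_mul_avoids hda hw₁ h
  have h₁ : σ .a ∣ w₂ * σ .a ^ l := ⟨p, mul_left_cancel (by rw [hp, mul_assoc])⟩
  have hl : Avoids .d (σ .a ^ l) := avoids_pow (by decide)
  have hw₂ : Avoids .d w₂ := by
    obtain ⟨v, m, rfl, hv, hm⟩ := exists_mul_of_leaf_dvd (by decide) (by decide) ha.2.2 hl h₁
    exact avoids_mul.2 ⟨hv, hm⟩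
  have hw₁b : Avoids .b w₁ := by
    by_contra hb
    obtain ⟨y, -, rfl⟩ := exists_eq_mul_σ (by decide) hw₁ hb
    rw [avoids_mul] at hw₁
    obtain ⟨q, hq⟩ := dvd_of_dvd_mul_avoids hda hw₁.1 (by simpa only [mul_assoc] using h)
    obtain ⟨k, hk, hk'⟩ := of_d (by decide) (hq.trans (mul_assoc _ _ _))
    have := mul_dvd_of_leaf_dvd_d (by decide)
      (dvd_of_leaf_dvd_leaf (by decide) (by decide) (by decide) ⟨q, hk'.symm⟩)
    have hav : Avoids .d (σ .b * k) :=
      mul_left_cancel hk ▸ avoids_mul.2 ⟨hw₂, hl⟩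
    simpa using (avoids_mul.1 hav).2.of_dvd this
  obtain rfl := eq_one_of_avoids (x := w₁) fun s => by cases s <;> tauto
  refine ⟨w₂, ?_, ha.2.2⟩
  rw [one_mul, mul_assoc, mul_assoc,
    ((commute_σ_of_avoids_d (s := .a) (by decide) hw₂).pow_left l).eq]

namespace Triangle.Reduced

variable {X : Set Artin} {A D : Fin 3 → Set Artin} {i j k : Fin 3}
  (h : Triangle.Reduced X A D)
include h

theorem common_D_A_avoids (hij : i ≠ j) : ∃ m, ι m ∈ D i ∧ ι m ∈ A j ∧ Avoids .c m := by
  obtain ⟨m, hmD, hmA⟩ := h.common_D_A hij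
  obtain ⟨α, hα, hαc⟩ := h.exists_isMinRep_A j
  obtain ⟨δ, hδ, hδc⟩ := h.exists_isMinRep_D i
  obtain ⟨p, rfl⟩ := hα.dvd m hmA
  obtain ⟨q, hq⟩ := hδ.dvd _ hmD
  obtain ⟨u, v, hl⟩ := exists_isLcm hq
  obtain ⟨w, rfl, rfl⟩ := hl.univ _ _ hq
  have hu := (avoids_mul.1 ((ι_mul_mem_iff (h.isCosetOf_A j) hα.mem).1 hmA)).1
  have hv := (avoids_mul.1 ((ι_mul_mem_iff (h.isCosetOf_D i) hδ.mem).1 (hq ▸ hmD))).1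
  exact ⟨α * u, hl.eq ▸ (ι_mul_mem_iff (h.isCosetOf_D i) hδ.mem).2 hv,
    (ι_mul_mem_iff (h.isCosetOf_A j) hα.mem).2 hu, avoids_mul.2 ⟨hαc, (hl.avoids .c hαc hδc).1⟩⟩

theorem exists_of_one_mem_D (hij : i ≠ j) (hik : i ≠ k) (hjk : j ≠ k) (hA : ι 1 ∈ A k)
    (hD : ι 1 ∈ D i) : ∃ Y, IsCosetOf Y (Ahat .b) ∧ Meets Y X ∧ ∀ l, Meets Y (A l) := by
  have h1 : ∀ l, l ≠ k → ι 1 ∉ A l := fun l hl h1 =>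
    hl (h.injective ((h.isCosetOf_A l).eq (h.isCosetOf_A k) (.of_mem h1 hA)))
  obtain ⟨α, hα, -⟩ := h.exists_isMinRep_A j
  have hαs := fun s => h.avoids_leaf_of_one_mem (t := s) hij hD hα
  have hAd : Starts .d (A i) := by
    obtain ⟨s, hs⟩ := h.exists_starts_A (h1 i hik)
    obtain rfl : s = .d := by
      by_contra hsd
      exact h.not_good_D hs ⟨1 * σ s, (ι_mul_mem_iff (h.isCosetOf_D i) hD).2 (avoids_σ.2 hsd),
        by rw [one_mul]⟩
    exact hs
  obtain ⟨p, hpD, hpA, hpc⟩ := h.common_D_A_avoids hik.symm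
  obtain ⟨q, hqD, hqA, hqc⟩ := h.common_D_A_avoids hjk.symm
  obtain ⟨p', q', hp', hq', e⟩ := exists_mul_eq_mul (h.isCosetOf_D k) hpD hqD
  obtain ⟨x, y, hl⟩ := exists_isLcm e
  obtain ⟨z, rfl, rfl⟩ := hl.univ _ _ e
  rw [avoids_mul] at hp' hq'
  obtain ⟨hxc, hyc⟩ := hl.avoids .c hpc hqc
  obtain ⟨u, n, rfl, hu⟩ := exists_eq_mul_pow hxc hp'.1
  obtain ⟨v, n', rfl, hv⟩ := exists_eq_mul_pow hyc hq'.1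
  have hPA := (ι_mul_mem_iff (h.isCosetOf_A i) hpA).2 hu
  have hQA := (ι_mul_mem_iff (h.isCosetOf_A j) hqA).2 hv
  have hQc := avoids_mul.2 ⟨hqc, (avoids_mul.1 hyc).1⟩
  have e' := hl.eq
  rw [← mul_assoc, ← mul_assoc] at e'
  obtain ⟨w, hw⟩ := hα.dvd _ hQA
  rw [hw] at hQA hQc e'
  have hwa := (ι_mul_mem_iff (h.isCosetOf_A j) hα.mem).1 hQA
  have hda : ∀ y, σ .d ∣ α * y → σ .d * σ .a ∣ y := fun y hy => by
    obtain rfl | ⟨s, α', rfl⟩ := eq_one_or α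
    · exact absurd hα.mem (h1 j hjk)
    simp only [avoids_mul, avoids_σ] at hαs
    obtain rfl : s = .a := by
      by_contra hs
      exact (hαs s hs).1 rfl
    exact dvd_of_dvd_mul_avoids (fun r hr y => mul_dvd_of_leaf (by decide) hr)
      (hαs .d (by decide)).2 (mul_dvd_of_d_dvd_leaf (by decide) (by rwa [← mul_assoc]))
  obtain ⟨l, e' | e'⟩ := exists_mul_pow_of_mul_pow_eq e'
  · rw [e', mul_assoc] at hPA
    obtain ⟨v, hv, hva⟩ := exists_eq_mul_of_d_mul_a_dvd hwa (avoids_mul.1 hQc).2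
      (hda _ (hAd _ hPA))
    rw [hv, ← mul_assoc] at hPA
    obtain ⟨Y, hY, hY1⟩ := exists_coset (ι 1) .b
    have hmem : ∀ m, Avoids .b m → ι m ∈ Y := fun m hm =>
      one_mul m ▸ (ι_mul_mem_iff hY hY1).2 hm
    refine ⟨Y, hY, .of_mem hY1 h.one_mem_X, fun l' => ?_⟩
    obtain rfl | rfl | rfl : l' = i ∨ l' = j ∨ l' = k := by omega
    · refine .of_mem (hmem _ ?_) (ι_mem_of_mul (h.isCosetOf_A l') hPA hva)
      simp [hαs, avoids_pow]
    · exact .of_mem (hmem _ (hαs .b (by decide))) hα.mem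
    · exact .of_mem hY1 hA
  · have := hda w (e' ▸ (hAd _ hPA).mul_right _)
    simpa using hwa.of_dvd this

end Triangle.Reduced

end D4Artin

namespace D4Artin
open ArtinMonoid

namespace Triangle.Reduced

variable {s : Gen} {X : Set Artin} {A D : Fin 3 → Set Artin} {i j k : Fin 3}
  (h : Triangle.Reduced X A D)
include h

theorem eq_b_or_eq_d_of_starts_D (hik : i ≠ k) (hA : ι 1 ∈ A k) (hs : Starts s (D i)) :
    s = .b ∨ s = .d := by
  obtain ⟨δ, hδ, -⟩ := h.exists_isMinRep_D i
  have ha : s ≠ .a := by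
    rintro rfl
    exact not_dvd_of_avoids (h.avoids_a_of_one_mem hik hA hδ) (hδ.starts_iff.1 hs)
  have hc := h.ne_c_of_starts_D hs
  cases s <;> simp_all

theorem not_starts_D (hij : i ≠ j) (hik : i ≠ k) (hjk : j ≠ k) (hA : ι 1 ∈ A k)
    (hj : Starts .b (D j)) (hi : Starts .d (D i)) : False := by
  have h1 : ∀ l, l ≠ k → ι 1 ∉ A l := fun l hl h1 =>
    hl (h.injective ((h.isCosetOf_A l).eq (h.isCosetOf_A k) (.of_mem h1 hA)))
  obtain ⟨α, hα, -⟩ := h.exists_isMinRep_A i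
  obtain ⟨β, hβ, -⟩ := h.exists_isMinRep_A j
  obtain ⟨δ, hδ, -⟩ := h.exists_isMinRep_D j
  obtain ⟨ε, hε, -⟩ := h.exists_isMinRep_D k
  have hib : Starts .b (A i) := by
    by_contra hb
    refine not_dvd_of_avoids (h.avoids_b hij hα hδ (fun s hs hs' => ?_) (h1 i hik) (by decide)
      (h.not_good_A hi)).2 (hδ.starts_iff.1 hj)
    obtain rfl | rfl := h.eq_b_or_eq_d_of_starts_D hjk hA hs'
    · exact hb hs
    · exact hij (h.eq_of_starts_D hi hs')
  have hD : ι 1 ∉ D k := fun hD => not_dvd_of_avoids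
    (h.avoids_leaf_of_one_mem hik.symm hD hα (by decide)) (hα.starts_iff.1 hib)
  have hDa : ∀ s, Starts s (D k) → s = .a := fun s hs => by
    by_contra hsa
    exact h.not_good_A hs
      ⟨1 * σ s, (ι_mul_mem_iff (h.isCosetOf_A k) hA).2 (avoids_σ.2 hsa), by rw [one_mul]⟩
  by_cases hja : Starts .a (A j)
  · refine not_dvd_of_avoids (h.avoids_b hik hα hε (fun s hs hs' => ?_) (h1 i hik) (by decide)
      (h.not_good_A hi)).1 (hα.starts_iff.1 hib)
    exact hij (h.eq_of_starts_A hs (hDa s hs' ▸ hja))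
  · have hεb := (h.avoids_b hjk hβ hε (fun s hs hs' => hja (hDa s hs' ▸ hs)) (h1 j hjk)
      (by decide) (h.not_good_A hj)).2
    obtain ⟨m, hm, hb⟩ := h.good_D hib hik.symm
    obtain ⟨v, rfl⟩ := hε.dvd m hm
    obtain ⟨x, y, rfl, hx, hy⟩ := exists_mul_of_leaf_dvd (by decide) (by decide) hεb
      ((ι_mul_mem_iff (h.isCosetOf_D k) hε.mem).1 hm) hb
    exact hD (ι_mem_of_mul (h.isCosetOf_D k) ((one_mul (x * y)).symm ▸ hε.mem)
      (avoids_mul.2 ⟨hx, hy⟩))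

theorem exists_isCosetOf_b : ∃ Y, IsCosetOf Y (Ahat .b) ∧ Meets Y X ∧ ∀ l, Meets Y (A l) := by
  obtain ⟨k, hA⟩ := h.exists_one_mem
  obtain ⟨i, hik, -⟩ := exists_ne_ne k k
  obtain ⟨j, hjk, hji⟩ := exists_ne_ne k i
  by_cases hDi : ι 1 ∈ D i
  · exact h.exists_of_one_mem_D hji.symm hik hjk hA hDi
  by_cases hDj : ι 1 ∈ D j
  · exact h.exists_of_one_mem_D hji hjk hik hA hDj
  exfalso
  obtain ⟨s, hs⟩ := h.exists_starts_D hDi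
  obtain ⟨t, ht⟩ := h.exists_starts_D hDj
  obtain rfl | rfl := h.eq_b_or_eq_d_of_starts_D hik hA hs <;>
    obtain rfl | rfl := h.eq_b_or_eq_d_of_starts_D hjk hA ht
  · exact hji (h.eq_of_starts_D ht hs)
  · exact h.not_starts_D hji hjk hik hA hs ht
  · exact h.not_starts_D hji.symm hik hjk hA ht hs
  · exact hji (h.eq_of_starts_D ht hs)

end Triangle.Reduced

theorem Triangle.exists_isCosetOf_b {X : Set Artin} {A D : Fin 3 → Set Artin}
    (h : Triangle X A D) : ∃ Y, IsCosetOf Y (Ahat .b) ∧ Meets Y X ∧ ∀ l, Meets Y (A l) := by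
  by_cases hD : ∃ i, Meets (D i) (A i)
  · obtain ⟨i, hi⟩ := hD
    obtain ⟨p, hpX, hpD⟩ := h.meets_D i
    obtain ⟨Y, hY, hpY⟩ := exists_coset p .b
    refine ⟨Y, hY, .of_mem hpY hpX, fun l => .join hY (h.isCosetOf_A l) (h.isCosetOf_D i)
      (by decide) (.of_mem hpY hpD) ?_⟩
    obtain rfl | hil := eq_or_ne i l
    exacts [hi.symm, (h.meets i l hil).symm]
  push Not at hD
  obtain ⟨g, hg⟩ := exists_normalized (S := insert X (Set.range A ∪ Set.range D))
    (((Set.finite_range A).union (Set.finite_range D)).insert X) (by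
      rintro Z (rfl | ⟨i, rfl⟩ | ⟨i, rfl⟩)
      exacts [⟨_, h.isCosetOf_X⟩, ⟨_, h.isCosetOf_A i⟩, ⟨_, h.isCosetOf_D i⟩])
  have hgT : Triangle.Reduced (g • X) (fun i => g • A i) (fun i => g • D i) :=
    { isCosetOf_X := h.isCosetOf_X.smul g
      isCosetOf_A := fun i => (h.isCosetOf_A i).smul g
      isCosetOf_D := fun i => (h.isCosetOf_D i).smul g
      injective := (MulAction.injective g).comp h.injective
      meets := fun i j hij => meets_smul.2 (h.meets i j hij)
      meets_A := fun i => meets_smul.2 (h.meets_A i)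
      meets_D := fun i => meets_smul.2 (h.meets_D i)
      not_meets := fun i hi => hD i (meets_smul.1 hi)
      normalized := by
        rwa [Set.image_insert_eq, Set.image_union, ← Set.range_comp, ← Set.range_comp] at hg }
  obtain ⟨Y, hY, hYX, hYA⟩ := hgT.exists_isCosetOf_b
  refine ⟨g⁻¹ • Y, hY.smul _, (meets_inv_smul.2 hYX.symm).symm,
    fun l => (meets_inv_smul.2 (hYA l).symm).symm⟩

end D4Artin

open D4Artin D4Artin.Gen

/-- Let `(x 0, …, x 5)` be a type I 6-cycle in the `D₄` Artin complex and let `x5'` be a left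
coset of `A_ĉ` meeting both `x 0` and `x 4`, with `x 1, x 3, x5'` pairwise distinct. If there
is a left coset of `A_â` or of `A_b̂` meeting each of `x 1`, `x 3`, `x5'`, then there is one
meeting each of `x 1`, `x 3`, `x 5`. -/
theorem typeI_replacement (x : Fin 6 → Set Artin) (hx : TypeI x)
    (x5' : Set Artin) (hx5' : IsCosetOf x5' (Ahat c))
    (h50 : (x5' ∩ x 0).Nonempty) (h54 : (x5' ∩ x 4).Nonempty)
    (hne1 : x 1 ≠ x5') (hne3 : x 3 ≠ x5') (hne13 : x 1 ≠ x 3)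
    (hz : ∃ z : Set Artin, (IsCosetOf z (Ahat a) ∨ IsCosetOf z (Ahat b)) ∧
      (z ∩ x 1).Nonempty ∧ (z ∩ x 3).Nonempty ∧ (z ∩ x5').Nonempty) :
    ∃ z' : Set Artin, (IsCosetOf z' (Ahat a) ∨ IsCosetOf z' (Ahat b)) ∧
      (z' ∩ x 1).Nonempty ∧ (z' ∩ x 3).Nonempty ∧ (z' ∩ x 5).Nonempty := by
  obtain ⟨h0, h2, h4, h1, h3, h5, h02, h04, h24, -, -, -, hmeet⟩ := hx
  have m01 : Meets (x 0) (x 1) := hmeet 0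
  have m34 : Meets (x 3) (x 4) := hmeet 3
  have m45 : Meets (x 4) (x 5) := hmeet 4
  have m50 : Meets (x 5) (x 0) := hmeet 5
  replace h50 : Meets x5' (x 0) := h50
  replace h54 : Meets x5' (x 4) := h54
  obtain ⟨z, hz, hz1, hz3, hz5⟩ := hz
  replace hz1 : Meets z (x 1) := hz1
  replace hz3 : Meets z (x 3) := hz3
  replace hz5 : Meets z x5' := hz5
  obtain h55 | h55 := eq_or_ne (x 5) x5'
  · exact ⟨z, hz, hz1, hz3, h55 ▸ hz5⟩
  obtain ⟨W, hW, hW5, hW5', hW0, hW4⟩ := exists_center (by decide) (by decide) (by decide)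
    h5 hx5' h55 h0 h4 h04 m50.symm h50.symm m45 h54.symm
  obtain hza | hzb := hz
  · obtain rfl | hz0 := eq_or_ne z (x 0)
    · exact ⟨_, .inl hza, hz1, hz3, m50.symm⟩
    obtain rfl | hz4 := eq_or_ne z (x 4)
    · exact ⟨_, .inl hza, hz1, hz3, m45⟩
    obtain ⟨W₁, hW₁, hW₁1, hW₁5, hW₁0, hW₁z⟩ := exists_center (by decide) (by decide) (by decide)
      h1 hx5' hne1 h0 hza hz0.symm m01 h50.symm hz1 hz5
    obtain ⟨W₂, hW₂, hW₂3, hW₂5, hW₂4, hW₂z⟩ := exists_center (by decide) (by decide) (by decide)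
      h3 hx5' hne3 h4 hza hz4.symm m34.symm h54.symm hz3 hz5
    have hT : Triangle x5' ![x 0, z, x 4] ![W₂, W, W₁] :=
      { isCosetOf_X := hx5'
        isCosetOf_A := by simp [Fin.forall_fin_succ, h0, hza, h4]
        isCosetOf_D := by simp [Fin.forall_fin_succ, hW₂, hW, hW₁]
        injective := by
          simp [Function.Injective, Fin.forall_fin_succ, h04, h04.symm, hz0, hz0.symm, hz4,
            hz4.symm]
        meets := by simp [Fin.forall_fin_succ, hW₂z, hW₂4, hW0, hW4, hW₁0, hW₁z]
        meets_A := by simp [Fin.forall_fin_succ, h50, hz5.symm, h54]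
        meets_D := by simp [Fin.forall_fin_succ, hW₂5.symm, hW5'.symm, hW₁5.symm] }
    obtain ⟨Y, hY, -, hYA⟩ := hT.exists_isCosetOf_b
    have hY0 : Meets Y (x 0) := hYA 0
    have hYz : Meets Y z := hYA 1
    have hY4 : Meets Y (x 4) := hYA 2
    refine ⟨Y, .inr hY, Meets.join hY h1 hW₁ (by decide) ?_ hW₁1.symm,
      Meets.join hY h3 hW₂ (by decide) ?_ hW₂3.symm, Meets.join hY h5 hW (by decide) ?_ hW5.symm⟩
    · exact meets_of_meets_pair (by decide) h0 hza hz0.symm hW₁ hW₁0 hW₁z hY (by decide) hY0 hYz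
    · exact meets_of_meets_pair (by decide) h4 hza hz4.symm hW₂ hW₂4 hW₂z hY (by decide) hY4 hYz
    · exact meets_of_meets_pair (by decide) h0 h4 h04 hW hW0 hW4 hY (by decide) hY0 hY4
  · have hz0 : Meets z (x 0) := meets_of_square (by decide) h1 hx5' hne1 hzb (by decide) h0
      (by decide) (by decide) hz1 hz5 m01 h50.symm
    have hz4 : Meets z (x 4) := meets_of_square (by decide) h3 hx5' hne3 hzb (by decide) h4
      (by decide) (by decide) hz3 hz5 m34.symm h54.symm
    have hzW := meets_of_meets_pair (by decide) h0 h4 h04 hW hW0 hW4 hzb (by decide) hz0 hz4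
    exact ⟨z, .inr hzb, hz1, hz3, Meets.join hzb h5 hW (by decide) hzW hW5.symm⟩
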